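/- arXiv:2503.06880 — 5 statements merged into one kernel-verified Lean document; each statement's English description precedes it below -/
import Mathlib

section
/- A Banach space X is not reflexive if and only if for every θ ∈ (0,1) there exist sequences (x_i) in the closed unit ball of X and (g_n) in the open unit ball of X* such that g_n(x_i) = θ for i ≥ n and g_n(x_i) = 0 for i < n. -/
set_option maxSynthPendingDepth 3

/-- **Helly's theorem**: a vector `c` of a finite-dimensional space `V` satisfying the dual norm
inequality with constant `M` is attained by `T` on every open ball of radius larger than `M`. -/
theorem ContinuousLinearMap.exists_norm_lt_map_eq {E V : Type*} [NormedAddCommGroup E]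
    [NormedSpace ℝ E] [NormedAddCommGroup V] [NormedSpace ℝ V] [FiniteDimensional ℝ V]
    (T : E →L[ℝ] V) (c : V) {M R : ℝ} (hM : 0 ≤ M) (hMR : M < R)
    (h : ∀ φ : V →L[ℝ] ℝ, φ c ≤ M * ‖φ.comp T‖) : ∃ x, ‖x‖ < R ∧ T x = c := by
  obtain ⟨r, hMr, hrR⟩ := exists_between hMR
  have hr : 0 < r := hM.trans_lt hMr
  have hc : c ∈ closure (T '' Metric.closedBall 0 r) := by
    by_contra hc
    have hconv : Convex ℝ (closure (T '' Metric.closedBall 0 r)) :=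
      ((convex_closedBall (0 : E) r).linear_image T.toLinearMap).closure
    obtain ⟨φ, u, hu, huc⟩ := geometric_hahn_banach_closed_point hconv isClosed_closure hc
    have hball : ∀ x : E, ‖x‖ ≤ r → φ (T x) ≤ u := fun x hx =>
      (hu _ (subset_closure ⟨x, by simpa using hx, rfl⟩)).le
    have hu0 : 0 ≤ u := by simpa using hball 0 (by simpa using hr.le)
    have hnorm : ‖φ.comp T‖ ≤ u / r := by
      refine ContinuousLinearMap.opNorm_le_of_unit_norm (by positivity) fun x hx => ?_
      have h1 := hball (r • x) (by simp [norm_smul, hx, abs_of_pos hr])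
      have h2 := hball (-(r • x)) (by simp [norm_smul, hx, abs_of_pos hr])
      simp only [map_neg, map_smul, smul_eq_mul] at h1 h2
      rw [le_div_iff₀ hr, Real.norm_eq_abs, ContinuousLinearMap.comp_apply]
      cases abs_cases (φ (T x)) <;> nlinarith
    have h1 : r * ‖φ.comp T‖ ≤ u := by rwa [le_div_iff₀' hr] at hnorm
    have h2 := mul_le_mul_of_nonneg_right hMr.le (norm_nonneg (φ.comp T))
    linarith [h φ]
  let W := T.toLinearMap.range
  have hW : IsClosed (W : Set V) := W.closed_of_finiteDimensional
  have hcW : c ∈ W :=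
    closure_minimal (by rintro _ ⟨x, -, rfl⟩; exact ⟨x, rfl⟩) hW hc
  obtain ⟨S, hS⟩ := T.toLinearMap.rangeRestrict.exists_rightInverse_of_surjective
    T.toLinearMap.range_rangeRestrict
  let S' : W →L[ℝ] E := S.toContinuousLinearMap
  have hTS : ∀ w : W, T (S' w) = w := fun w =>
    congrArg Subtype.val (LinearMap.congr_fun hS w)
  obtain ⟨_, ⟨x, hx, rfl⟩, hxc⟩ := Metric.mem_closure_iff.1 hc ((R - r) / (‖S'‖ + 1))
    (div_pos (sub_pos.2 hrR) (by positivity))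
  let w : W := ⟨c - T x, W.sub_mem hcW ⟨x, rfl⟩⟩
  refine ⟨x + S' w, ?_, by simp [hTS, w]⟩
  have hw : ‖w‖ * (‖S'‖ + 1) < R - r := by
    rw [dist_eq_norm] at hxc
    exact (lt_div_iff₀ (by positivity)).1 hxc
  have hSw : ‖S' w‖ ≤ ‖S'‖ * ‖w‖ := S'.le_opNorm w
  have hxr : ‖x‖ ≤ r := by simpa using hx
  have := norm_add_le x (S' w)
  nlinarith [norm_nonneg w]

/-- Every element of the bidual agrees on a finite set of functionals with evaluation at a vector
of almost the same norm. -/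
theorem ContinuousLinearMap.exists_norm_lt_forall_apply_eq {X : Type*} [NormedAddCommGroup X]
    [NormedSpace ℝ X] (F : StrongDual ℝ (StrongDual ℝ X)) {R : ℝ} (hF : ‖F‖ < R)
    (s : Finset (X →L[ℝ] ℝ)) : ∃ x : X, ‖x‖ < R ∧ ∀ g ∈ s, g x = F g := by
  classical
  let T := ContinuousLinearMap.pi fun g : s => (g : X →L[ℝ] ℝ)
  obtain ⟨x, hx, hTx⟩ := T.exists_norm_lt_map_eq (fun g : s => F g) (norm_nonneg F) hF fun φ => by
      have h : φ (fun g : s => F g) = F (φ.comp T) := by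
        have h1 : φ.comp T =
            ∑ g : s, φ (fun j => if g = j then 1 else 0) • (g : X →L[ℝ] ℝ) := by
          ext x
          have := φ.toLinearMap.pi_apply_eq_sum_univ (fun g : s => (g : X →L[ℝ] ℝ) x)
          simpa [T, mul_comm] using this
        rw [h1, map_sum]
        have := φ.toLinearMap.pi_apply_eq_sum_univ (fun g : s => F g)
        simpa [mul_comm] using this
      rw [h]
      exact (le_abs_self _).trans (F.le_opNorm _)
  exact ⟨x, hx, fun g hg => congrFun hTx ⟨g, hg⟩⟩

theorem LinearIsometry.abs_mul_le_norm_smul_add {X E : Type*} [NormedAddCommGroup X]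
    [NormedSpace ℝ X] [NormedAddCommGroup E] [NormedSpace ℝ E] (J : X →ₗᵢ[ℝ] E) {v : E} {d : ℝ}
    (hv : ∀ x, d ≤ ‖v - J x‖) (a : ℝ) (x : X) : |a| * d ≤ ‖a • v + J x‖ := by
  rcases eq_or_ne a 0 with rfl | ha
  · simp
  · have h : a • v + J x = a • (v - J (-(a⁻¹ • x))) := by
      rw [map_neg, map_smul, sub_neg_eq_add, smul_add, smul_smul, mul_inv_cancel₀ ha, one_smul]
    rw [h, norm_smul, Real.norm_eq_abs]
    exact mul_le_mul_of_nonneg_left (hv _) (abs_nonneg a)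

/-- A version of Riesz's lemma for the range of a linear isometry, with the vector in the open unit
ball. -/
theorem LinearIsometry.exists_norm_lt_one_forall_le_norm_sub {X E : Type*} [NormedAddCommGroup X]
    [NormedSpace ℝ X] [CompleteSpace X] [NormedAddCommGroup E] [NormedSpace ℝ E] (J : X →ₗᵢ[ℝ] E)
    (hJ : ¬ Function.Surjective J) {d : ℝ} (hd0 : 0 < d) (hd : d < 1) :
    ∃ v : E, ‖v‖ < 1 ∧ ∀ x : X, d ≤ ‖v - J x‖ := by
  obtain ⟨t, hdt, ht⟩ := exists_between hd
  have ht0 : 0 < t := hd0.trans hdt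
  let Y : Submodule ℝ E := J.toLinearMap.range
  have hY : IsClosed (Y : Set E) := J.isometry.isClosedEmbedding.isClosed_range
  obtain ⟨v, hv⟩ : ∃ v, v ∉ Y := by
    by_contra! h
    exact hJ h
  obtain ⟨w, hw, hwY⟩ := riesz_lemma hY ⟨v, hv⟩ ((div_lt_one ht0).2 hdt)
  have hw0 : 0 < ‖w‖ := norm_pos_iff.2 fun h => hw (h ▸ Y.zero_mem)
  refine ⟨(t / ‖w‖) • w, ?_, fun x => ?_⟩
  · rw [norm_smul, Real.norm_of_nonneg (by positivity), div_mul_cancel₀ _ hw0.ne']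
    exact ht
  · have h : (t / ‖w‖) • w - J x = (t / ‖w‖) • (w - J ((‖w‖ / t) • x)) := by
      rw [map_smul, smul_sub, smul_smul, show t / ‖w‖ * (‖w‖ / t) = 1 by field_simp, one_smul]
    rw [h, norm_smul, Real.norm_of_nonneg (by positivity)]
    calc d = t / ‖w‖ * (d / t * ‖w‖) := by field_simp
      _ ≤ _ := mul_le_mul_of_nonneg_left (hwY _ ⟨_, rfl⟩) (by positivity)

open NormedSpace in
/-- If `F` has distance at least `d > θ` from `X` in the bidual, then `F` attains the value `θ`
on the open unit ball of the annihilator of every finite subset of `X`. -/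
theorem NormedSpace.exists_norm_lt_one_apply_eq_forall_eq_zero {X : Type*} [NormedAddCommGroup X]
    [NormedSpace ℝ X] (F : StrongDual ℝ (StrongDual ℝ X)) {θ d : ℝ} (hθ : 0 ≤ θ) (hd : θ < d)
    (hF : ∀ x : X, d ≤ ‖F - inclusionInDoubleDual ℝ X x‖) (s : Finset X) :
    ∃ g : X →L[ℝ] ℝ, ‖g‖ < 1 ∧ F g = θ ∧ ∀ x ∈ s, g x = 0 := by
  classical
  have hd0 : 0 < d := hθ.trans_lt hd
  let P := ContinuousLinearMap.pi fun x : s => inclusionInDoubleDual ℝ X (x : X)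
  obtain ⟨g, hg, hTg⟩ := (F.prod P).exists_norm_lt_map_eq (θ, 0) (M := θ / d) (R := 1)
    (by positivity) ((div_lt_one hd0).2 hd) fun φ => by
      let a := φ (1, 0)
      let z : X := ∑ x : s, φ (0, fun j => if x = j then 1 else 0) • (x : X)
      have h0 : φ (θ, 0) = θ * a := by
        have : ((θ, 0) : ℝ × (s → ℝ)) = θ • (1, 0) := by simp
        rw [this, map_smul, smul_eq_mul]
      have h1 : φ.comp (F.prod P) = a • F + inclusionInDoubleDual ℝ X z := by
        ext g
        have h2 : φ (F g, P g) = φ (F g • (1, 0)) + φ (0, P g) := by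
          rw [← map_add]; simp
        have h3 := (φ.comp (ContinuousLinearMap.inr ℝ ℝ (s → ℝ))).toLinearMap.pi_apply_eq_sum_univ
          (P g)
        have h4 : φ (0, P g) = g z := by
          simpa [z, P, mul_comm] using h3
        simp only [ContinuousLinearMap.comp_apply, ContinuousLinearMap.prod_apply,
          add_apply, smul_apply, dual_def]
        rw [h2, h4, map_smul, smul_eq_mul, smul_eq_mul, mul_comm]
      have h2 : |a| * d ≤ ‖φ.comp (F.prod P)‖ := by
        rw [h1]
        let J := inclusionInDoubleDualLi (E := X) ℝ
        exact LinearIsometry.abs_mul_le_norm_smul_add J hF a z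
      rw [h0]
      calc θ * a ≤ θ * |a| := mul_le_mul_of_nonneg_left (le_abs_self a) hθ
        _ = θ / d * (|a| * d) := by field_simp
        _ ≤ _ := mul_le_mul_of_nonneg_left h2 (by positivity)
  exact ⟨g, hg, congrArg Prod.fst hTg, fun x hx => congrFun (congrArg Prod.snd hTg) ⟨x, hx⟩⟩

open NormedSpace Filter Topology in
/-- In a reflexive space, bounded sequences converge weakly along some free ultrafilter. -/
theorem NormedSpace.exists_forall_tendsto_hyperfilter {X : Type*} [NormedAddCommGroup X]
    [NormedSpace ℝ X] (hX : Function.Surjective (inclusionInDoubleDual ℝ X)) {x : ℕ → X}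
    (hx : ∀ i, ‖x i‖ ≤ 1) :
    ∃ z : X, ∀ f : X →L[ℝ] ℝ, Tendsto (fun i => f (x i)) (hyperfilter ℕ) (𝓝 (f z)) := by
  have hK := WeakDual.isCompact_closedBall (𝕜 := ℝ) (E := X →L[ℝ] ℝ) 0 1
  let y : ℕ → WeakDual ℝ (X →L[ℝ] ℝ) := fun i =>
    StrongDual.toWeakDual (inclusionInDoubleDual ℝ X (x i))
  obtain ⟨F, -, hF⟩ := hK.ultrafilter_le_nhds ((hyperfilter ℕ).map y) (by
    rw [Ultrafilter.coe_map, le_principal_iff, mem_map]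
    refine univ_mem' fun i => ?_
    simpa [y] using (double_dual_bound ℝ X (x i)).trans (hx i))
  obtain ⟨z, hz⟩ := hX (WeakDual.toStrongDual F)
  refine ⟨z, fun f => ?_⟩
  have h1 : Tendsto y (hyperfilter ℕ) (𝓝 F) := hF
  have h2 := ((WeakDual.eval_continuous f).tendsto F).comp h1
  have h3 : F f = f z := by
    rw [← dual_def ℝ X z f, hz]; rfl
  rw [h3] at h2
  exact h2

/-- A Banach space is non-reflexive iff for every `θ ∈ (0,1)` there are sequences in the
closed unit ball of `X` and the open unit ball of `X*` forming a "staircase". -/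
theorem nonreflexive_iff_staircase {X : Type*} [NormedAddCommGroup X] [NormedSpace ℝ X]
    [CompleteSpace X] :
    ¬ Function.Surjective (NormedSpace.inclusionInDoubleDual ℝ X) ↔
    ∀ θ ∈ Set.Ioo (0:ℝ) 1, ∃ (x : ℕ → X) (g : ℕ → (X →L[ℝ] ℝ)),
      (∀ i, ‖x i‖ ≤ 1) ∧ (∀ n, ‖g n‖ < 1) ∧
      (∀ n i, n ≤ i → g n (x i) = θ) ∧ (∀ n i, i < n → g n (x i) = 0) := by
  classical
  constructor
  · rintro hX θ ⟨hθ0, hθ1⟩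
    obtain ⟨d, hθd, hd1⟩ := exists_between hθ1
    let J := NormedSpace.inclusionInDoubleDualLi (E := X) ℝ
    obtain ⟨F, hF1, hFd⟩ := LinearIsometry.exists_norm_lt_one_forall_le_norm_sub
      J hX (hθ0.trans hθd) hd1
    obtain ⟨p, hp, hpp⟩ := exists_seq_of_forall_finset_exists
      (fun p : X × (X →L[ℝ] ℝ) => ‖p.1‖ ≤ 1 ∧ ‖p.2‖ < 1 ∧ F p.2 = θ ∧ p.2 p.1 = θ)
      (fun p q => q.2 p.1 = 0 ∧ p.2 q.1 = θ) fun s hs => by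
        obtain ⟨g, hg1, hFg, hg⟩ := NormedSpace.exists_norm_lt_one_apply_eq_forall_eq_zero F hθ0.le
          hθd hFd (s.image Prod.fst)
        obtain ⟨x, hx1, hx⟩ := F.exists_norm_lt_forall_apply_eq hF1 (insert g (s.image Prod.snd))
        refine ⟨(x, g), ⟨hx1.le, hg1, hFg, ?_⟩, fun p hp => ⟨?_, ?_⟩⟩
        · exact (hx g (Finset.mem_insert_self _ _)).trans hFg
        · exact hg _ (Finset.mem_image_of_mem _ hp)
        · exact (hx _ (Finset.mem_insert_of_mem (Finset.mem_image_of_mem _ hp))).trans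
            (hs p hp).2.2.1
    refine ⟨fun i => (p i).1, fun n => (p n).2, fun i => (hp i).1, fun n => (hp n).2.1,
      fun n i hni => ?_, fun n i hin => (hpp i n hin).1⟩
    rcases hni.eq_or_lt with rfl | hni
    · exact (hp n).2.2.2
    · exact (hpp n i hni).2
  · intro h hX
    obtain ⟨x, g, hx, hg, hθ, h0⟩ := h (1 / 2) (by norm_num)
    obtain ⟨z, hz⟩ := NormedSpace.exists_forall_tendsto_hyperfilter hX hx
    have hgz : ∀ n, g n z = 1 / 2 := fun n => by
      refine tendsto_nhds_unique (hz (g n)) (tendsto_const_nhds.congr' ?_)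
      refine Filter.Eventually.filter_mono Nat.hyperfilter_le_atTop ?_
      filter_upwards [Filter.eventually_ge_atTop n] with i hi using (hθ n i hi).symm
    have hzc : z ∈ closure (convexHull ℝ (Set.range x)) := by
      by_contra hzc
      obtain ⟨f, u, hu, huz⟩ := geometric_hahn_banach_closed_point
        (convex_convexHull ℝ (Set.range x)).closure isClosed_closure hzc
      refine huz.not_ge (le_of_tendsto (hz f) (Filter.univ_mem' fun i => ?_))
      exact (hu _ (subset_closure (subset_convexHull ℝ _ ⟨i, rfl⟩))).le
    obtain ⟨y, hy, hzy⟩ := Metric.mem_closure_iff.1 hzc (1 / 2) (by norm_num)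
    have hspan : ∀ y ∈ Submodule.span ℝ (Set.range x), ∀ᶠ n in Filter.atTop, g n y = 0 := by
      intro y hy
      induction hy using Submodule.span_induction with
      | mem y hy =>
        obtain ⟨i, rfl⟩ := hy
        filter_upwards [Filter.eventually_gt_atTop i] with n hn using h0 n i hn
      | zero => simp
      | add y w _ _ hy hw => filter_upwards [hy, hw] with n h1 h2 using by simp [h1, h2]
      | smul a y _ hy => filter_upwards [hy] with n h1 using by simp [h1]
    obtain ⟨n, hn⟩ := (hspan y (convexHull_min Submodule.subset_span
      (Submodule.span ℝ (Set.range x)).convex hy)).exists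
    have h1 : ‖g n (z - y)‖ ≤ ‖g n‖ * ‖z - y‖ := (g n).le_opNorm _
    rw [map_sub, hn, hgz, dist_eq_norm] at *
    norm_num at h1
    nlinarith [norm_nonneg (z - y), hg n]
end

section
/- Let X be a Banach space, S a weakly closed subset, and suppose every f ∈ X* attains its supremum on S. Then S is weakly compact. Conversely, if S is weakly compact then every f ∈ X* attains its supremum on S. -/
open Filter Topology NormedSpace

section Liminf

/-- The limit inferior of a real sequence along the indices lying in `A`. -/
noncomputable def liminfOn (u : ℕ → ℝ) (A : Set ℕ) : ℝ :=
  liminf u (atTop ⊓ 𝓟 A)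

variable {u : ℕ → ℝ} {M : ℝ} {A A' : Set ℕ}

theorem Set.Infinite.neBot_atTop_inf_principal (hA : A.Infinite) : (atTop ⊓ 𝓟 A).NeBot :=
  frequently_mem_iff_neBot.1 (Nat.frequently_atTop_iff_infinite.2 hA)

theorem isBoundedUnder_ge_of_forall_abs_le (hu : ∀ k, |u k| ≤ M) (l : Filter ℕ) :
    IsBoundedUnder (· ≥ ·) l u :=
  isBoundedUnder_of ⟨-M, fun k => (abs_le.1 (hu k)).1⟩

theorem isCoboundedUnder_ge_of_forall_abs_le (hu : ∀ k, |u k| ≤ M) (l : Filter ℕ) [l.NeBot] :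
    IsCoboundedUnder (· ≥ ·) l u :=
  (isBoundedUnder_of (r := (· ≤ ·)) ⟨M, fun k => (abs_le.1 (hu k)).2⟩).isCoboundedUnder_flip

theorem liminfOn_mono (hu : ∀ k, |u k| ≤ M) (hA' : A'.Infinite) (h : A' ⊆ A) :
    liminfOn u A ≤ liminfOn u A' := by
  have := hA'.neBot_atTop_inf_principal
  exact liminf_le_liminf_of_le (inf_le_inf_left _ (principal_mono.2 h))
    (isBoundedUnder_ge_of_forall_abs_le hu _) (isCoboundedUnder_ge_of_forall_abs_le hu _)

theorem abs_liminfOn_le (hu : ∀ k, |u k| ≤ M) (hA : A.Infinite) : |liminfOn u A| ≤ M := by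
  have := hA.neBot_atTop_inf_principal
  refine abs_le.2 ⟨?_, ?_⟩
  · exact le_liminf_of_le (isCoboundedUnder_ge_of_forall_abs_le hu _)
      (Eventually.of_forall fun k => (abs_le.1 (hu k)).1)
  · exact liminf_le_of_frequently_le
      (Eventually.of_forall fun k => (abs_le.1 (hu k)).2).frequently
      (isBoundedUnder_ge_of_forall_abs_le hu _)

theorem liminfOn_le_of_eventually_le (hu : ∀ k, |u k| ≤ M) (hA : A.Infinite) {a : ℝ}
    (h : ∀ᶠ k in atTop, u k ≤ a) : liminfOn u A ≤ a := by
  have := hA.neBot_atTop_inf_principal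
  exact liminf_le_of_frequently_le (h.filter_mono inf_le_left).frequently
    (isBoundedUnder_ge_of_forall_abs_le hu _)

theorem exists_forall_lt_of_lt_liminfOn (hu : ∀ k, |u k| ≤ M) {a : ℝ} (h : a < liminfOn u A) :
    ∃ N, ∀ k ∈ A, N ≤ k → a < u k := by
  have h' := eventually_lt_of_lt_liminf h (isBoundedUnder_ge_of_forall_abs_le hu _)
  rw [eventually_inf_principal, eventually_atTop] at h'
  obtain ⟨N, hN⟩ := h'
  exact ⟨N, fun k hk hNk => hN k hNk hk⟩

theorem infinite_setOf_lt_of_liminfOn_lt (hu : ∀ k, |u k| ≤ M) (hA : A.Infinite) {b : ℝ}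
    (h : liminfOn u A < b) (N : ℕ) : {k ∈ A | N ≤ k ∧ u k < b}.Infinite := by
  have := hA.neBot_atTop_inf_principal
  have h' := frequently_lt_of_liminf_lt (isCoboundedUnder_ge_of_forall_abs_le hu _) h
  rw [frequently_inf_principal] at h'
  refine Nat.frequently_atTop_iff_infinite.1 ?_
  exact (h'.and_eventually (eventually_ge_atTop N)).mono fun k hk => ⟨hk.1.1, hk.2, hk.1.2⟩

end Liminf

section Gap

variable {X : Type*} [NormedAddCommGroup X] [NormedSpace ℝ X]

/-- The supremum over `S` of `h - b • liminf f`, the limit inferior being taken along `A`. -/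
noncomputable def supGap (S : Set X) (f : ℕ → StrongDual ℝ X) (A : Set ℕ) (h : StrongDual ℝ X)
    (b : ℝ) : ℝ :=
  ⨆ x : S, (h x - b * liminfOn (fun k => f k x) A)

variable {S : Set X} {f : ℕ → StrongDual ℝ X} {M : ℝ} {A A' : Set ℕ}

theorem abs_apply_le_of_norm_le_one {g : StrongDual ℝ X} (hg : ‖g‖ ≤ 1) {x : X} (hx : ‖x‖ ≤ M) :
    |g x| ≤ M :=
  (g.le_of_opNorm_le hg x).trans (by simpa using hx)

theorem le_supGap (hS : ∀ x ∈ S, ‖x‖ ≤ M) (hf : ∀ k, ‖f k‖ ≤ 1) (hA : A.Infinite)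
    (h : StrongDual ℝ X) (b : ℝ) {x : X} (hx : x ∈ S) :
    h x - b * liminfOn (fun k => f k x) A ≤ supGap S f A h b := by
  refine le_ciSup (f := fun x : S => h x - b * liminfOn (fun k => f k x) A)
    ⟨‖h‖ * M + |b| * M, ?_⟩ ⟨x, hx⟩
  rintro _ ⟨⟨y, hy⟩, rfl⟩
  have h1 : |h y| ≤ ‖h‖ * M := (h.le_opNorm y).trans (by gcongr; exact hS y hy)
  have h2 : |liminfOn (fun k => f k y) A| ≤ M :=
    abs_liminfOn_le (fun k => abs_apply_le_of_norm_le_one (hf k) (hS y hy)) hA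
  have h3 : |b * liminfOn (fun k => f k y) A| ≤ |b| * M := by rw [abs_mul]; gcongr
  have := (abs_le.1 h1).2
  have := (abs_le.1 h3).1
  simp only
  linarith

theorem supGap_le (hne : S.Nonempty) {h : StrongDual ℝ X} {b c : ℝ}
    (hc : ∀ x ∈ S, h x - b * liminfOn (fun k => f k x) A ≤ c) : supGap S f A h b ≤ c := by
  have := hne.to_subtype
  exact ciSup_le fun x => hc x x.2

theorem exists_lt_of_lt_supGap (hne : S.Nonempty) {h : StrongDual ℝ X} {b c : ℝ}
    (hc : c < supGap S f A h b) : ∃ x ∈ S, c < h x - b * liminfOn (fun k => f k x) A := by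
  by_contra! H
  exact hc.not_ge (supGap_le hne H)

theorem supGap_anti (hne : S.Nonempty) (hS : ∀ x ∈ S, ‖x‖ ≤ M) (hf : ∀ k, ‖f k‖ ≤ 1)
    (hA : A.Infinite) (hA' : A'.Infinite) (hAA : A' ⊆ A) (h : StrongDual ℝ X) {b : ℝ}
    (hb : 0 ≤ b) : supGap S f A' h b ≤ supGap S f A h b := by
  refine supGap_le hne fun x hx => le_trans ?_ (le_supGap hS hf hA h b hx)
  have := liminfOn_mono (fun k => abs_apply_le_of_norm_le_one (hf k) (hS x hx)) hA' hAA
  gcongr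

theorem supGap_convex (hne : S.Nonempty) (hS : ∀ x ∈ S, ‖x‖ ≤ M) (hf : ∀ k, ‖f k‖ ≤ 1)
    (hA : A.Infinite) (h d : StrongDual ℝ X) (b c : ℝ) {r : ℝ} (hr : 0 < r) :
    (1 + r) * supGap S f A (h + d) (b + c) ≤
      supGap S f A (h + (1 + r) • d) (b + (1 + r) * c) + r * supGap S f A h b := by
  have hr' : 0 < 1 + r := by linarith
  rw [← le_div_iff₀' hr']
  refine supGap_le hne fun x hx => ?_
  rw [le_div_iff₀' hr']
  have h1 := le_supGap hS hf hA (h + (1 + r) • d) (b + (1 + r) * c) hx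
  have h2 := mul_le_mul_of_nonneg_left (le_supGap hS hf hA h b hx) hr.le
  simp only [add_apply, smul_apply, smul_eq_mul] at h1 ⊢
  linarith

/-- The inductive step in the James construction. -/
theorem exists_refinement (hne : S.Nonempty) (hS : ∀ x ∈ S, ‖x‖ ≤ M) (hf : ∀ k, ‖f k‖ ≤ 1)
    (hA : A.Infinite) {h : StrongDual ℝ X} {b β r α α' δ : ℝ} (hb : 0 ≤ b) (hβ : 0 < β)
    (hr : 0 < r) (hα : α' < α) (hδ : δ < α)
    (hinv : ∀ A' ⊆ A, A'.Infinite → ∀ g ∈ convexHull ℝ (f '' A),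
      β * α + supGap S f A h b ≤ supGap S f A' (h + β • g) (b + β)) (N : ℕ) :
    ∃ A₂ ⊆ A, A₂.Infinite ∧ (∀ k ∈ A₂, N ≤ k) ∧ ∃ g ∈ convexHull ℝ (f '' A),
      (∀ A' ⊆ A₂, A'.Infinite → ∀ g' ∈ convexHull ℝ (f '' A₂),
        r * β * α' + supGap S f A₂ (h + β • g) (b + β) ≤
          supGap S f A' (h + β • g + (r * β) • g') (b + β + r * β)) ∧
      ∃ x ∈ S, ∀ k ∈ A₂, β * δ + supGap S f A h b ≤ (h + β • g) x - (b + β) * f k x := by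
  set P := supGap S f A h b
  let T : Set ℝ := {t | ∃ A' ⊆ A, A'.Infinite ∧ ∃ g ∈ convexHull ℝ (f '' A),
    supGap S f A' (h + β • g) (b + β) = t}
  have hTb : ∀ t ∈ T, β * α + P ≤ t := by
    rintro _ ⟨A', hA'A, hA', g, hg, rfl⟩
    exact hinv A' hA'A hA' g hg
  have hTne : T.Nonempty := by
    obtain ⟨k, hk⟩ := hA.nonempty
    exact ⟨_, A, subset_rfl, hA, f k, subset_convexHull ℝ _ ⟨k, hk, rfl⟩, rfl⟩
  have hJ : β * α + P ≤ sInf T := le_csInf hTne hTb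
  have hJle : ∀ t ∈ T, sInf T ≤ t := fun t ht => csInf_le ⟨_, hTb⟩ ht
  obtain ⟨_, ⟨A', hA'A, hA', g, hg, rfl⟩, hlt⟩ :=
    exists_lt_of_csInf_lt hTne (show sInf T < sInf T + r * β * (α - α') by
      have : 0 < r * β * (α - α') := mul_pos (mul_pos hr hβ) (sub_pos.2 hα)
      linarith)
  have hbβ : 0 < b + β := by linarith
  obtain ⟨x, hx, hxlt⟩ := exists_lt_of_lt_supGap (c := β * δ + P) hne
    (lt_of_lt_of_le (by gcongr) (hinv A' hA'A hA' g hg))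
  set c := ((h + β • g) x - (β * δ + P)) / (b + β) with hc
  have hlim : liminfOn (fun k => f k x) A' < c := by
    rw [hc, lt_div_iff₀' hbβ]; linarith
  set A₂ := {k ∈ A' | N ≤ k ∧ f k x < c}
  have hA₂ : A₂.Infinite := infinite_setOf_lt_of_liminfOn_lt
    (fun k => abs_apply_le_of_norm_le_one (hf k) (hS x hx)) hA' hlim N
  have hA₂A' : A₂ ⊆ A' := fun k hk => hk.1
  refine ⟨A₂, hA₂A'.trans hA'A, hA₂, fun k hk => hk.2.1, g, hg, ?_, x, hx, fun k hk => ?_⟩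
  · intro A'' hA''A₂ hA'' g' hg'
    have hg'A : g' ∈ convexHull ℝ (f '' A) :=
      convexHull_mono (Set.image_mono (hA₂A'.trans hA'A)) hg'
    have hr1 : (1 + r) ≠ 0 := by positivity
    set m : StrongDual ℝ X := (1 / (1 + r)) • g + (r / (1 + r)) • g' with hm
    have hmem : m ∈ convexHull ℝ (f '' A) :=
      (convex_convexHull ℝ _) hg hg'A (by positivity) (by positivity) (by field_simp)
    have h1 := hJle _ ⟨A'', hA''A₂.trans (hA₂A'.trans hA'A), hA'', m, hmem, rfl⟩
    have h2 := supGap_convex hne hS hf hA'' h (β • m) b β hr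
    have e1 : h + (1 + r) • β • m = h + β • g + (r * β) • g' := by
      have : (1 + r) • β • m = β • g + (r * β) • g' := by
        rw [hm]; match_scalars <;> field_simp
      rw [this, add_assoc]
    have e2 : b + (1 + r) * β = b + β + r * β := by ring
    rw [e1, e2] at h2
    have h3 : supGap S f A'' h b ≤ P :=
      supGap_anti hne hS hf hA hA'' (hA''A₂.trans (hA₂A'.trans hA'A)) h hb
    have h4 : supGap S f A₂ (h + β • g) (b + β) ≤ supGap S f A' (h + β • g) (b + β) :=
      supGap_anti hne hS hf hA' hA₂ hA₂A' _ hbβ.le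
    have h5 := mul_le_mul_of_nonneg_left h1 (by linarith : (0 : ℝ) ≤ 1 + r)
    have h6 := mul_le_mul_of_nonneg_left h3 hr.le
    have h7 := mul_le_mul_of_nonneg_left hJ hr.le
    linarith
  · have := hk.2.2
    rw [hc, lt_div_iff₀' hbβ] at this
    linarith

end Gap

section Limit

variable {E : Type*} [NormedAddCommGroup E] [NormedSpace ℝ E]

/-- A bounded sequence of functionals converges pointwise along an ultrafilter. -/
theorem exists_tendsto_apply_of_norm_le (V : Ultrafilter ℕ) {φ : ℕ → StrongDual ℝ E} {C : ℝ}
    (hφ : ∀ n, ‖φ n‖ ≤ C) :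
    ∃ φ₀ : StrongDual ℝ E, ‖φ₀‖ ≤ C ∧ ∀ x, Tendsto (fun n => φ n x) V (𝓝 (φ₀ x)) := by
  obtain ⟨w, hw, hlim⟩ := (WeakDual.isCompact_closedBall (𝕜 := ℝ) (0 : StrongDual ℝ E) C)
    |>.ultrafilter_le_nhds (V.map fun n => StrongDual.toWeakDual (φ n)) (by
      rw [le_principal_iff]
      exact Eventually.of_forall (f := (V : Filter ℕ)) fun n => by simpa using hφ n)
  refine ⟨WeakDual.toStrongDual w, by simpa using hw, fun x => ?_⟩
  exact ((WeakDual.eval_continuous x).tendsto w).comp hlim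

end Limit

section James

variable {X : Type*} [NormedAddCommGroup X] [NormedSpace ℝ X]

theorem apply_le_of_mem_convexHull {s : Set (StrongDual ℝ X)} {x : X} {c : ℝ}
    (hs : ∀ f ∈ s, f x ≤ c) {g : StrongDual ℝ X} (hg : g ∈ convexHull ℝ s) : g x ≤ c := by
  refine convexHull_min (t := {g : StrongDual ℝ X | g x ≤ c}) hs ?_ hg
  exact convex_halfSpace_le (f := fun g : StrongDual ℝ X => g x)
    ⟨fun _ _ => rfl, fun _ _ => rfl⟩ c

theorem le_apply_of_mem_convexHull {s : Set (StrongDual ℝ X)} {x : X} {c : ℝ}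
    (hs : ∀ f ∈ s, c ≤ f x) {g : StrongDual ℝ X} (hg : g ∈ convexHull ℝ s) : c ≤ g x := by
  refine convexHull_min (t := {g : StrongDual ℝ X | c ≤ g x}) hs ?_ hg
  exact convex_halfSpace_ge (f := fun g : StrongDual ℝ X => g x)
    ⟨fun _ _ => rfl, fun _ _ => rfl⟩ c

theorem norm_le_one_of_mem_convexHull {s : Set (StrongDual ℝ X)} (hs : ∀ f ∈ s, ‖f‖ ≤ 1)
    {g : StrongDual ℝ X} (hg : g ∈ convexHull ℝ s) : ‖g‖ ≤ 1 := by
  have := convexHull_min (t := Metric.closedBall (0 : StrongDual ℝ X) 1)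
    (fun f hf => by simpa using hs f hf) (convex_closedBall _ _) hg
  simpa using this

/-- The sequences produced by iterating `exists_refinement`. -/
theorem exists_refinement_seq {S : Set X} (hne : S.Nonempty) {M : ℝ} (hS : ∀ x ∈ S, ‖x‖ ≤ M)
    {f : ℕ → StrongDual ℝ X} (hf : ∀ k, ‖f k‖ ≤ 1) {θ : ℝ} (hθ : 0 < θ)
    (hgap : ∀ A : Set ℕ, A.Infinite → ∀ g ∈ convexHull ℝ (Set.range f),
      ∃ x ∈ S, θ ≤ g x - liminfOn (fun k => f k x) A) {r : ℝ} (hr : 0 < r) :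
    ∃ (A : ℕ → Set ℕ) (g : ℕ → StrongDual ℝ X) (x : ℕ → X),
      (∀ n, (A n).Infinite) ∧ (∀ n, A (n + 1) ⊆ A n) ∧ (∀ n, ∀ k ∈ A (n + 1), n ≤ k) ∧
      (∀ n, g n ∈ convexHull ℝ (f '' A n)) ∧ (∀ n, x n ∈ S) ∧
      ∀ n, ∀ k ∈ A (n + 1),
        r ^ n * (θ / 2) + supGap S f (A n) (∑ i ∈ Finset.range n, r ^ i • g i)
          (∑ i ∈ Finset.range n, r ^ i) ≤
        (∑ i ∈ Finset.range (n + 1), r ^ i • g i) (x n) -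
          (∑ i ∈ Finset.range (n + 1), r ^ i) * f k (x n) := by
  let B : ℕ → ℝ := fun n => ∑ i ∈ Finset.range n, r ^ i
  let α : ℕ → ℝ := fun n => θ / 2 + θ / 2 * (1 / 2) ^ n
  have hB : ∀ n, 0 ≤ B n := fun n => Finset.sum_nonneg fun i _ => by positivity
  have hBs : ∀ n, B (n + 1) = B n + r ^ n := fun n => Finset.sum_range_succ _ _
  have hα : ∀ n, α (n + 1) < α n := fun n => by
    have : 0 < θ / 2 * (1 / 2) ^ n := by positivity
    simp only [α, pow_succ]; linarith
  have hαθ : ∀ n, θ / 2 < α n := fun n => by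
    have : 0 < θ / 2 * (1 / 2) ^ n := by positivity
    simp only [α]; linarith
  let Inv : ℕ → Set ℕ × StrongDual ℝ X → Prop := fun n p => p.1.Infinite ∧
    ∀ A' ⊆ p.1, A'.Infinite → ∀ g ∈ convexHull ℝ (f '' p.1),
      r ^ n * α n + supGap S f p.1 p.2 (B n) ≤ supGap S f A' (p.2 + r ^ n • g) (B n + r ^ n)
  have hstep : ∀ n (p : {p // Inv n p}), ∃ q : {q // Inv (n + 1) q},
      q.1.1 ⊆ p.1.1 ∧ (∀ k ∈ q.1.1, n ≤ k) ∧ ∃ g ∈ convexHull ℝ (f '' p.1.1), ∃ x ∈ S,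
        q.1.2 = p.1.2 + r ^ n • g ∧ ∀ k ∈ q.1.1,
          r ^ n * (θ / 2) + supGap S f p.1.1 p.1.2 (B n) ≤
            q.1.2 x - B (n + 1) * f k x := by
    rintro n ⟨⟨A, h⟩, hA, hinv⟩
    obtain ⟨A₂, hA₂A, hA₂, hN, g, hg, hinv', x, hx, hxk⟩ :=
      exists_refinement hne hS hf hA (hB n) (pow_pos hr n) hr (hα n) (hαθ n) hinv n
    refine ⟨⟨⟨A₂, h + r ^ n • g⟩, hA₂, ?_⟩, hA₂A, hN, g, hg, x, hx, rfl, ?_⟩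
    · simpa only [hBs, pow_succ'] using hinv'
    · simpa only [hBs] using hxk
  choose q hqA hqN g hg x hx hqh hqx using hstep
  have h0 : Inv 0 (Set.univ, 0) := by
    refine ⟨Set.infinite_univ, fun A' _ hA' g hg => ?_⟩
    obtain ⟨y, hy, hle⟩ := hgap A' hA' g (by simpa using hg)
    have h1 : supGap S f Set.univ 0 0 ≤ 0 := supGap_le hne fun y _ => by simp
    have h2 := le_supGap hS hf hA' g 1 hy
    simp only [B, α, Finset.sum_range_zero, pow_zero, one_smul, zero_add, one_mul, mul_one] at h2 ⊢
    linarith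
  let p : ∀ n, {p // Inv n p} := fun n => Nat.rec ⟨_, h0⟩ (fun n p => q n p) n
  have hh : ∀ n, (p n).1.2 = ∑ i ∈ Finset.range n, r ^ i • g i (p i) := by
    intro n
    induction n with
    | zero => rfl
    | succ n ih => rw [Finset.sum_range_succ, ← ih]; exact hqh n (p n)
  refine ⟨fun n => (p n).1.1, fun n => g n (p n), fun n => x n (p n), fun n => (p n).2.1,
    fun n => hqA n (p n), fun n => hqN n (p n), fun n => hg n (p n), fun n => hx n (p n),
    fun n k hk => ?_⟩
  rw [← hh, ← hh]
  exact hqx n (p n) k hk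

/-- A bounded set carrying a sequence of functionals whose convex combinations stay away from its
limits inferior admits a functional that does not attain its supremum. -/
theorem exists_not_sup_attained {S : Set X} (hne : S.Nonempty) {M : ℝ} (hS : ∀ x ∈ S, ‖x‖ ≤ M)
    {f : ℕ → StrongDual ℝ X} (hf : ∀ k, ‖f k‖ ≤ 1) {θ : ℝ} (hθ : 0 < θ)
    (hgap : ∀ A : Set ℕ, A.Infinite → ∀ g ∈ convexHull ℝ (Set.range f),
      ∃ x ∈ S, θ ≤ g x - liminfOn (fun k => f k x) A) :
    ∃ H : StrongDual ℝ X, ∀ u ∈ S, ∃ x ∈ S, H u < H x := by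
  wlog hM : 0 < M generalizing M
  · exact this (M := |M| + 1) (fun x hx => (hS x hx).trans (by linarith [le_abs_self M]))
      (by positivity)
  set r := θ / (θ + 16 * M) with hr
  have hr0 : 0 < r := by positivity
  have hr1 : r < 1 := by rw [hr, div_lt_one (by positivity)]; linarith
  have hr2 : 4 * M * r / (1 - r) = θ / 4 := by
    have : 1 - r = 16 * M / (θ + 16 * M) := by rw [hr]; field_simp; ring
    rw [this, hr]; field_simp; ring
  obtain ⟨A, g, x, hA, hAs, hAN, hg, hx, hmain⟩ :=
    exists_refinement_seq hne hS hf hθ hgap hr0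
  have hAanti : Antitone A := antitone_nat_of_succ_le hAs
  have hg1 : ∀ n, ‖g n‖ ≤ 1 := fun n =>
    norm_le_one_of_mem_convexHull (by rintro _ ⟨k, -, rfl⟩; exact hf k) (hg n)
  obtain ⟨g₀, hg₀1, hlim⟩ := exists_tendsto_apply_of_norm_le (hyperfilter ℕ) hg1
  have hev : ∀ N, ∀ᶠ n in (hyperfilter ℕ : Filter ℕ), N ≤ n := fun N =>
    Nat.hyperfilter_le_atTop (eventually_ge_atTop N)
  have hliminf : ∀ n, ∀ y ∈ S, liminfOn (fun k => f k y) (A n) ≤ g₀ y := by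
    intro n y hy
    refine le_of_forall_lt fun a ha => ?_
    obtain ⟨a', haa', ha'⟩ := exists_between ha
    obtain ⟨N, hN⟩ := exists_forall_lt_of_lt_liminfOn
      (fun k => abs_apply_le_of_norm_le_one (hf k) (hS y hy)) ha'
    refine haa'.trans_le (ge_of_tendsto (hlim y) ?_)
    filter_upwards [hev (N + n + 1)] with m hm
    refine le_apply_of_mem_convexHull ?_ (hg m)
    rintro _ ⟨k, hk, rfl⟩
    obtain ⟨m, rfl⟩ : ∃ m', m = m' + 1 := ⟨m - 1, by omega⟩
    exact (hN k (hAanti (by omega) hk) (le_trans (by omega) (hAN m k hk))).le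
  have hupper : ∀ n y c, (∀ k ∈ A n, f k y ≤ c) → g₀ y ≤ c := by
    intro n y c hc
    refine le_of_tendsto (hlim y) ?_
    filter_upwards [hev n] with m hm
    refine apply_le_of_mem_convexHull ?_ (hg m)
    rintro _ ⟨k, hk, rfl⟩
    exact hc k (hAanti hm hk)
  let t : ℕ → StrongDual ℝ X := fun i => r ^ i • (g i - g₀)
  have ht : ∀ i, ‖t i‖ ≤ 2 * r ^ i := by
    intro i
    have : ‖g i - g₀‖ ≤ 2 := (norm_sub_le _ _).trans (by linarith [hg1 i])
    rw [norm_smul, Real.norm_of_nonneg (by positivity), mul_comm]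
    gcongr
  have hsum : Summable t := Summable.of_norm_bounded
    ((summable_geometric_of_lt_one hr0.le hr1).mul_left 2) ht
  set H := ∑' i, t i
  have htail : ∀ n, ∀ y ∈ S, |(∑ i ∈ Finset.range (n + 1), t i) y - H y| ≤ r ^ n * (θ / 8) := by
    intro n y hy
    have h1 := norm_sub_le_of_geometric_bound_of_hasSum hr1 ht hsum.hasSum (n + 1)
    have h2 := (∑ i ∈ Finset.range (n + 1), t i - H).le_of_opNorm_le h1 y
    have hpos : 0 ≤ 2 * r ^ (n + 1) / (1 - r) := div_nonneg (by positivity) (by linarith)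
    calc |(∑ i ∈ Finset.range (n + 1), t i) y - H y|
        ≤ 2 * r ^ (n + 1) / (1 - r) * ‖y‖ := h2
      _ ≤ 2 * r ^ (n + 1) / (1 - r) * M := by gcongr; exact hS y hy
      _ = r ^ n / 2 * (4 * M * r / (1 - r)) := by ring
      _ = r ^ n * (θ / 8) := by rw [hr2]; ring
  have hpartial : ∀ n y, (∑ i ∈ Finset.range n, t i) y =
      (∑ i ∈ Finset.range n, r ^ i • g i) y - (∑ i ∈ Finset.range n, r ^ i) * g₀ y := by
    intro n y
    simp only [t, smul_sub, Finset.sum_sub_distrib, ← Finset.sum_smul,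
      sub_apply, smul_apply, smul_eq_mul]
  have hBpos : ∀ n, 0 < ∑ i ∈ Finset.range (n + 1), r ^ i := fun n =>
    Finset.sum_pos (fun i _ => by positivity) ⟨0, by simp⟩
  have hB0 : ∀ n, 0 ≤ ∑ i ∈ Finset.range n, r ^ i := fun n =>
    Finset.sum_nonneg fun i _ => by positivity
  refine ⟨H, fun u hu => ?_⟩
  by_contra! hmax
  have hkey : ∀ n, g₀ u + θ / 4 ≤ g n u := by
    intro n
    have h1 : r ^ n * (θ / 2) + supGap S f (A n) (∑ i ∈ Finset.range n, r ^ i • g i)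
        (∑ i ∈ Finset.range n, r ^ i) ≤ (∑ i ∈ Finset.range (n + 1), t i) (x n) := by
      have h2 := hupper (n + 1) (x n) (((∑ i ∈ Finset.range (n + 1), r ^ i • g i) (x n) -
        (r ^ n * (θ / 2) + supGap S f (A n) (∑ i ∈ Finset.range n, r ^ i • g i)
        (∑ i ∈ Finset.range n, r ^ i))) / (∑ i ∈ Finset.range (n + 1), r ^ i)) fun k hk => by
          rw [le_div_iff₀' (hBpos n)]
          linarith [hmain n k hk]
      rw [le_div_iff₀' (hBpos n)] at h2
      rw [hpartial]
      linarith
    have h3 := le_supGap hS hf (hA n) (∑ i ∈ Finset.range n, r ^ i • g i)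
      (∑ i ∈ Finset.range n, r ^ i) hu
    have h4 := mul_le_mul_of_nonneg_left (hliminf n u hu) (hB0 n)
    have h5 := (abs_le.1 (htail n (x n) (hx n))).2
    have h6 := (abs_le.1 (htail n u hu)).1
    have h7 := hmax (x n) (hx n)
    have h8 := hpartial n u
    have h9 : (∑ i ∈ Finset.range (n + 1), t i) u =
        (∑ i ∈ Finset.range n, t i) u + r ^ n * (g n u - g₀ u) := by
      rw [Finset.sum_range_succ]; rfl
    have h10 : r ^ n * (θ / 4) ≤ r ^ n * (g n u - g₀ u) := by linarith
    linarith [le_of_mul_le_mul_left h10 (pow_pos hr0 n)]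
  have := ge_of_tendsto (hlim u) (Eventually.of_forall hkey)
  linarith

/-- A functional bounded by `θ` on the unit ball of a finite intersection of kernels is within `θ`
of the span of the corresponding functionals. -/
theorem exists_mem_span_norm_sub_le {ι : Type*} [Finite ι] (L : ι → StrongDual ℝ X)
    (z : StrongDual ℝ X) {θ : ℝ} (hθ : 0 ≤ θ)
    (hz : ∀ x, ‖x‖ ≤ 1 → (∀ i, L i x = 0) → z x ≤ θ) :
    ∃ v ∈ Submodule.span ℝ (Set.range L), ‖z - v‖ ≤ θ := by
  let p : Submodule ℝ X := ⨅ i, (L i).toLinearMap.ker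
  have hp : ∀ {x}, x ∈ p ↔ ∀ i, L i x = 0 := by simp [p]
  obtain ⟨g, hg, hgn⟩ := exists_extension_norm_eq p (z.comp p.subtypeL)
  have hnorm : ‖z.comp p.subtypeL‖ ≤ θ := by
    refine ContinuousLinearMap.opNorm_le_of_unit_norm hθ fun x hx => ?_
    rw [Real.norm_eq_abs, abs_le']
    have hx' : ‖(x : X)‖ = 1 := hx
    refine ⟨hz x hx'.le (hp.1 x.2), ?_⟩
    have := hz (-x) (by rw [norm_neg]; exact hx'.le) (hp.1 (p.neg_mem x.2))
    simpa using this
  have hmem : (z - g).toLinearMap ∈ Submodule.span ℝ (Set.range fun i => (L i).toLinearMap) := by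
    refine mem_span_of_iInf_ker_le_ker fun x hx => ?_
    have := hg ⟨x, hx⟩
    simpa [sub_eq_zero] using this.symm
  have hspan : Submodule.span ℝ (Set.range fun i => (L i).toLinearMap) =
      (Submodule.span ℝ (Set.range L)).map (ContinuousLinearMap.coeLM ℝ) := by
    rw [Submodule.map_span, ← Set.range_comp]
    rfl
  rw [hspan] at hmem
  obtain ⟨v, hv, hvz⟩ := hmem
  have hvz' : v = z - g := ContinuousLinearMap.coe_injective hvz
  refine ⟨v, hv, ?_⟩
  rwa [hvz', sub_sub_cancel, hgn]

/-- A functional on the dual at distance more than `θ` from `X` exceeds `θ` at some functional in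
the unit ball vanishing on a given finite set. -/
theorem exists_vanishing_lt_apply {z : StrongDual ℝ (StrongDual ℝ X)} {θ : ℝ} (hθ : 0 ≤ θ)
    (hz : ∀ x, θ < ‖z - inclusionInDoubleDual ℝ X x‖) (s : Finset X) :
    ∃ f : StrongDual ℝ X, ‖f‖ ≤ 1 ∧ (∀ x ∈ s, f x = 0) ∧ θ < z f := by
  by_contra! H
  obtain ⟨v, hv, hvn⟩ := exists_mem_span_norm_sub_le
    (fun x : s => inclusionInDoubleDual ℝ X x) z hθ
    fun f hf hf0 => H f hf fun x hx => hf0 ⟨x, hx⟩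
  have hle : Submodule.span ℝ (Set.range fun x : s => inclusionInDoubleDual ℝ X x) ≤
      (inclusionInDoubleDual ℝ X).toLinearMap.range :=
    Submodule.span_le.2 (by rintro _ ⟨x, rfl⟩; exact ⟨x, rfl⟩)
  obtain ⟨x, rfl⟩ := hle hv
  exact (hz x).not_ge hvn

theorem LinearIsometry.exists_pos_forall_lt_norm_sub [CompleteSpace X] {F : Type*}
    [SeminormedAddCommGroup F] [NormedSpace ℝ F] [T0Space F] (e : X →ₗᵢ[ℝ] F)
    {z : F} (hz : z ∉ Set.range e) :
    ∃ θ > 0, ∀ x, θ < ‖z - e x‖ := by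
  have hcl := e.isometry.isUniformInducing.isComplete_range.isClosed
  have hd := (hcl.notMem_iff_infDist_pos
    (Set.range_nonempty _)).1 hz
  refine ⟨_, half_pos hd, fun x => (half_lt_self hd).trans_le ?_⟩
  rw [← dist_eq_norm]
  exact Metric.infDist_le_dist_of_mem ⟨x, rfl⟩

/-- If the weak-star closure of `S` in the bidual leaves `X`, then `S` carries a triangular
system of points and functionals. -/
theorem exists_triangular_seq [CompleteSpace X] {S : Set X}
    {w : WeakDual ℝ (StrongDual ℝ X)}
    (hw : w ∈ closure (inclusionInDoubleDualWeak ℝ X '' (toWeakSpace ℝ X '' S)))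
    (hwr : w ∉ Set.range (inclusionInDoubleDualWeak ℝ X)) :
    ∃ θ > 0, ∃ (f : ℕ → StrongDual ℝ X) (x : ℕ → X), (∀ n, ‖f n‖ ≤ 1) ∧ (∀ n, x n ∈ S) ∧
      (∀ m n, m ≤ n → θ ≤ f m (x n)) ∧ ∀ m n, m < n → f n (x m) = 0 := by
  set z := WeakDual.toStrongDual w
  have hzr : z ∉ Set.range (inclusionInDoubleDualLi (E := X) ℝ) := by
    rintro ⟨x, hx⟩
    exact hwr ⟨toWeakSpace ℝ X x, hx⟩
  obtain ⟨θ, hθ, hz⟩ := LinearIsometry.exists_pos_forall_lt_norm_sub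
    (F := StrongDual ℝ (StrongDual ℝ X)) (inclusionInDoubleDualLi ℝ) hzr
  have happrox : ∀ F : Finset (StrongDual ℝ X), (∀ f ∈ F, θ < z f) →
      ∃ x ∈ S, ∀ f ∈ F, θ < f x := by
    intro F hF
    have hopen : IsOpen (⋂ f ∈ F, {v : WeakDual ℝ (StrongDual ℝ X) | θ < v f}) :=
      isOpen_biInter_finset fun f _ => isOpen_lt continuous_const (WeakDual.eval_continuous f)
    obtain ⟨_, hv, _, ⟨x, hx, rfl⟩, rfl⟩ :=
      mem_closure_iff.1 hw _ hopen (Set.mem_iInter₂.2 hF)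
    exact ⟨x, hx, fun f hf => Set.mem_iInter₂.1 hv f hf⟩
  classical
  obtain ⟨y, hy, hyr⟩ := exists_seq_of_forall_finset_exists
    (fun p : StrongDual ℝ X × X => ‖p.1‖ ≤ 1 ∧ θ < z p.1 ∧ p.2 ∈ S ∧ θ < p.1 p.2)
    (fun p q => q.1 p.2 = 0 ∧ θ < p.1 q.2) (by
      intro s hs
      obtain ⟨f, hf1, hf0, hfz⟩ := exists_vanishing_lt_apply hθ.le hz (s.image Prod.snd)
      obtain ⟨x, hx, hxs⟩ := happrox (insert f (s.image Prod.fst)) (by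
        simp only [Finset.forall_mem_insert, Finset.forall_mem_image]
        exact ⟨hfz, fun p hp => (hs p hp).2.1⟩)
      simp only [Finset.forall_mem_insert, Finset.forall_mem_image] at hxs hf0
      exact ⟨(f, x), ⟨hf1, hfz, hx, hxs.1⟩, fun p hp => ⟨hf0 hp, hxs.2 hp⟩⟩)
  refine ⟨θ, hθ, fun n => (y n).1, fun n => (y n).2, fun n => (hy n).1,
    fun n => (hy n).2.2.1, fun m n hmn => ?_, fun m n hmn => (hyr m n hmn).1⟩
  rcases hmn.eq_or_lt with rfl | h
  · exact (hy m).2.2.2.le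
  · exact (hyr m n h).2.le

theorem exists_forall_norm_le_of_sup_attained {S : Set X}
    (hS : ∀ f : StrongDual ℝ X, ∃ s₀ ∈ S, ∀ s ∈ S, f s ≤ f s₀) : ∃ M, ∀ x ∈ S, ‖x‖ ≤ M := by
  obtain ⟨M, hM⟩ := banach_steinhaus (g := fun x : S => inclusionInDoubleDual ℝ X x) (by
    intro f
    obtain ⟨a, -, ha⟩ := hS f
    obtain ⟨b, -, hb⟩ := hS (-f)
    refine ⟨max (f a) (-f b), fun x => ?_⟩
    rw [dual_def, Real.norm_eq_abs, abs_le']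
    exact ⟨(ha x x.2).trans (le_max_left _ _), (hb x x.2).trans (le_max_right _ _)⟩)
  refine ⟨M, fun x hx => ?_⟩
  rw [← (inclusionInDoubleDualLi (E := X) ℝ).norm_map x]
  exact hM ⟨x, hx⟩

/-- **James theorem**, for weakly closed sets that need not be convex. -/
theorem isCompact_toWeakSpace_image_of_sup_attained [CompleteSpace X] {S : Set X}
    (hne : S.Nonempty) (hclosed : IsClosed (toWeakSpace ℝ X '' S))
    (hS : ∀ f : StrongDual ℝ X, ∃ s₀ ∈ S, ∀ s ∈ S, f s ≤ f s₀) :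
    IsCompact (toWeakSpace ℝ X '' S) := by
  obtain ⟨M, hM⟩ := exists_forall_norm_le_of_sup_attained hS
  rw [← hclosed.closure_eq]
  refine isCompact_closure_of_isBounded ℝ X _ ?_ fun w hw => ?_
  · rw [Set.preimage_image_eq _ (toWeakSpace ℝ X).injective]
    exact isBounded_iff_forall_norm_le.2 ⟨M, hM⟩
  by_contra hwr
  obtain ⟨θ, hθ, f, x, hf, hx, hle, hzero⟩ := exists_triangular_seq hw hwr
  obtain ⟨H, hH⟩ := exists_not_sup_attained hne hM hf hθ (by
    intro A hA g hg
    obtain ⟨m, hm⟩ : ∃ m, g ∈ convexHull ℝ (f '' Set.Iic m) := by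
      have hdir : Directed (· ⊆ ·) fun m => convexHull ℝ (f '' Set.Iic m) :=
        Monotone.directed_le fun _ _ hab =>
          convexHull_mono (Set.image_mono (Set.Iic_subset_Iic.2 hab))
      refine Set.mem_iUnion.1 (convexHull_min ?_
        (hdir.convex_iUnion fun _ => convex_convexHull ℝ _) hg)
      rintro _ ⟨k, rfl⟩
      exact Set.mem_iUnion.2 ⟨k, subset_convexHull ℝ _ ⟨k, Set.mem_Iic.2 le_rfl, rfl⟩⟩
    refine ⟨x m, hx m, ?_⟩
    have h1 : θ ≤ g (x m) := le_apply_of_mem_convexHull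
      (by rintro _ ⟨k, hk, rfl⟩; exact hle k m hk) hm
    have h2 : liminfOn (fun k => f k (x m)) A ≤ 0 := liminfOn_le_of_eventually_le
      (fun k => abs_apply_le_of_norm_le_one (hf k) (hM _ (hx m))) hA
      ((eventually_gt_atTop m).mono fun k hk => (hzero m k hk).le)
    linarith)
  obtain ⟨u, hu, hmax⟩ := hS H
  obtain ⟨y, hy, hlt⟩ := hH u hu
  exact hlt.not_ge (hmax y hy)

end James

/-- James-type theorem: a nonempty weakly closed subset of a Banach space is weakly compact
iff every continuous linear functional attains its supremum on it. -/
theorem weaklyClosed_weaklyCompact_iff_sup_attained {X : Type*} [NormedAddCommGroup X]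
    [NormedSpace ℝ X] [CompleteSpace X]
    (S : Set X) (hne : S.Nonempty)
    (hclosed : IsClosed (toWeakSpace ℝ X '' S)) :
    IsCompact (toWeakSpace ℝ X '' S) ↔
      ∀ f : X →L[ℝ] ℝ, ∃ s₀ ∈ S, ∀ s ∈ S, f s ≤ f s₀ := by
  refine ⟨fun hc f => ?_, isCompact_toWeakSpace_image_of_sup_attained hne hclosed⟩
  obtain ⟨_, ⟨s₀, hs₀, rfl⟩, hmax⟩ := hc.exists_isMaxOn (hne.image _)
    (WeakBilin.eval_continuous (topDualPairing ℝ X).flip f).continuousOn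
  exact ⟨s₀, hs₀, fun s hs => hmax ⟨s, hs, rfl⟩⟩
end

section
/- If a Banach space B contains a closed subspace linearly isomorphic to ℓ¹, then there exists f ∈ B* that does not attain its norm on the closed unit ball of B. -/
open Filter Topology Set

section JamesSequence

variable {E : Type*} [NormedAddCommGroup E] [NormedSpace ℝ E]

/-- A bounded sequence of functionals converges pointwise along the hyperfilter. -/
lemma exists_pointwise_hyperfilter_limit (g : ℕ → E →L[ℝ] ℝ) (R : ℝ) (hg : ∀ n, ‖g n‖ ≤ R) :
    ∃ w : E →L[ℝ] ℝ, ∀ x, Tendsto (fun n => g n x) (hyperfilter ℕ) (𝓝 (w x)) := by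
  have hc := WeakDual.isCompact_closedBall (𝕜 := ℝ) (0 : StrongDual ℝ E) R
  obtain ⟨w, -, hw⟩ := hc.ultrafilter_le_nhds
    ((hyperfilter ℕ).map fun n => StrongDual.toWeakDual (g n)) (by
      rw [le_principal_iff]
      refine Ultrafilter.mem_coe.2 (Ultrafilter.mem_map.2 (Eventually.of_forall fun n => ?_))
      simpa using hg n)
  refine ⟨WeakDual.toStrongDual w, fun x => ?_⟩
  exact ((WeakDual.eval_continuous (𝕜 := ℝ) (E := E) x).tendsto w).comp hw

/-- `C` is convex and meets every member of the sequence of sets `K`. -/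
def ConvexMeeting (K : ℕ → Set (E →L[ℝ] ℝ)) (C : Set (E →L[ℝ] ℝ)) : Prop :=
  Convex ℝ C ∧ ∀ n, (C ∩ K n).Nonempty

/-- The functionals dominated pointwise by the upper limit of the sets `C ∩ K n`. -/
def limitFunctionals (K : ℕ → Set (E →L[ℝ] ℝ)) (C : Set (E →L[ℝ] ℝ)) : Set (E →L[ℝ] ℝ) :=
  {w | ∀ x t, (∃ n, ∀ f ∈ C ∩ K n, f x ≤ t) → w x ≤ t}

/-- Uniform bounds for `‖h + s • g - w‖` over all limit functionals `w` of some
refinement of `C`, for some `g ∈ C ∩ K n`. -/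
def distanceBounds (K : ℕ → Set (E →L[ℝ] ℝ)) (C : Set (E →L[ℝ] ℝ)) (h : E →L[ℝ] ℝ)
    (s : ℝ) (n : ℕ) : Set ℝ :=
  {t | ∃ C' ⊆ C, ConvexMeeting K C' ∧ ∃ g ∈ C ∩ K n,
    ∀ w ∈ limitFunctionals K C', ‖h + s • g - w‖ ≤ t}

variable {K : ℕ → Set (E →L[ℝ] ℝ)} {C C' : Set (E →L[ℝ] ℝ)} {R : ℝ}

lemma limitFunctionals_mono (h : C' ⊆ C) : limitFunctionals K C' ⊆ limitFunctionals K C :=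
  fun _ hw x t ⟨n, hn⟩ => hw x t ⟨n, fun f hf => hn f ⟨h hf.1, hf.2⟩⟩

lemma mem_limitFunctionals_of_tendsto (hK : Antitone K) {g : ℕ → E →L[ℝ] ℝ} {w : E →L[ℝ] ℝ}
    (hw : ∀ x, Tendsto (fun n => g n x) (hyperfilter ℕ) (𝓝 (w x))) (m : ℕ)
    (hg : ∀ n ≥ m, g n ∈ C ∩ K n) : w ∈ limitFunctionals K C := by
  rintro x t ⟨n, hn⟩
  refine le_of_tendsto (hw x) (Nat.hyperfilter_le_atTop ?_)
  filter_upwards [eventually_ge_atTop m, eventually_ge_atTop n] with k hkm hkn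
  exact hn _ ⟨(hg k hkm).1, hK hkn (hg k hkm).2⟩

lemma limitFunctionals_nonempty (hK : Antitone K) (hR : ∀ n, ∀ f ∈ K n, ‖f‖ ≤ R)
    (hC : ConvexMeeting K C) : (limitFunctionals K C).Nonempty := by
  choose g hg using hC.2
  obtain ⟨w, hw⟩ := exists_pointwise_hyperfilter_limit g R fun n => hR n _ (hg n).2
  exact ⟨w, mem_limitFunctionals_of_tendsto hK hw 0 fun n _ => hg n⟩

lemma norm_le_of_mem_limitFunctionals (hR : ∀ n, ∀ f ∈ K n, ‖f‖ ≤ R) (hR0 : 0 ≤ R)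
    {w : E →L[ℝ] ℝ} (hw : w ∈ limitFunctionals K C) : ‖w‖ ≤ R := by
  have key : ∀ x, w x ≤ R * ‖x‖ := fun x => hw x _ ⟨0, fun f hf =>
    (le_abs_self _).trans (f.le_of_opNorm_le (hR 0 f hf.2) x)⟩
  refine w.opNorm_le_bound hR0 fun x => abs_le.2 ⟨?_, key x⟩
  have := key (-x)
  rw [map_neg, norm_neg] at this
  linarith

lemma ConvexMeeting.inter_halfspace (hC : ConvexMeeting K C) {w : E →L[ℝ] ℝ}
    (hw : w ∈ limitFunctionals K C) (x : E) {ε : ℝ} (hε : 0 < ε) :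
    ConvexMeeting K (C ∩ {f | f x ≤ w x + ε}) := by
  refine ⟨hC.1.inter ?_, fun n => ?_⟩
  · intro f hf g hg a b ha hb hab
    simp only [mem_ofPred_eq] at hf hg ⊢
    simp only [add_apply, smul_apply, smul_eq_mul]
    calc a * f x + b * g x ≤ a * (w x + ε) + b * (w x + ε) := by gcongr
      _ = w x + ε := by rw [← add_mul, hab, one_mul]
  · by_contra hne
    have h := hw (-x) (-(w x + ε)) ⟨n, fun f hf => ?_⟩
    · rw [map_neg] at h
      linarith
    · rw [map_neg]
      by_contra hlt
      exact hne ⟨f, ⟨hf.1, by simp only [mem_ofPred_eq]; linarith⟩, hf.2⟩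

lemma le_of_mem_distanceBounds (hK : Antitone K) (hR : ∀ n, ∀ f ∈ K n, ‖f‖ ≤ R) {h : E →L[ℝ] ℝ}
    {s : ℝ} {n : ℕ} {t : ℝ} (ht : t ∈ distanceBounds K C h s n) : 0 ≤ t := by
  obtain ⟨C', -, hC', g, -, hg⟩ := ht
  obtain ⟨w, hw⟩ := limitFunctionals_nonempty hK hR hC'
  exact (norm_nonneg _).trans (hg w hw)

lemma distanceBounds_nonempty (hR : ∀ n, ∀ f ∈ K n, ‖f‖ ≤ R) (hR0 : 0 ≤ R)
    (hC : ConvexMeeting K C) (h : E →L[ℝ] ℝ) (s : ℝ) (n : ℕ) :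
    (distanceBounds K C h s n).Nonempty := by
  obtain ⟨g, hg⟩ := hC.2 n
  refine ⟨‖h + s • g‖ + R, C, Subset.rfl, hC, g, hg, fun w hw => ?_⟩
  exact (norm_sub_le _ _).trans (by gcongr; exact norm_le_of_mem_limitFunctionals hR hR0 hw)

/-- Near-optimal choice of a functional, together with a refinement on whose limit functionals
the distance is almost constant. -/
lemma exists_almost_constant_distance (hK : Antitone K)
    (hR : ∀ n, ∀ f ∈ K n, ‖f‖ ≤ R) (hR0 : 0 ≤ R) (hC : ConvexMeeting K C) (h : E →L[ℝ] ℝ)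
    (s : ℝ) (n : ℕ) {ε : ℝ} (hε : 0 < ε) :
    ∃ C' ⊆ C, ConvexMeeting K C' ∧ ∃ g ∈ C ∩ K n, ∀ w ∈ limitFunctionals K C',
      ‖h + s • g - w‖ ≤ sInf (distanceBounds K C h s n) + ε ∧
      sInf (distanceBounds K C h s n) ≤ ‖h + s • g - w‖ + ε := by
  set a := sInf (distanceBounds K C h s n)
  obtain ⟨t, ⟨C₁, hC₁C, hC₁, g, hg, hgt⟩, hta⟩ :=
    exists_lt_of_csInf_lt (distanceBounds_nonempty hR hR0 hC h s n)
      (show sInf (distanceBounds K C h s n) < a + ε by linarith)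
  have hbdd : BddBelow (distanceBounds K C h s n) :=
    ⟨0, fun t ht => le_of_mem_distanceBounds hK hR ht⟩
  obtain ⟨w₀, hw₀, hlt⟩ : ∃ w₀ ∈ limitFunctionals K C₁, a - ε / 2 < ‖h + s • g - w₀‖ := by
    by_contra! hcon
    have := csInf_le hbdd (show a - ε / 2 ∈ distanceBounds K C h s n from
      ⟨C₁, hC₁C, hC₁, g, hg, hcon⟩)
    linarith
  obtain ⟨x, hx, hxa⟩ : ∃ x : E, ‖x‖ ≤ 1 ∧ a - ε / 2 ≤ (h + s • g - w₀) x := by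
    obtain ⟨x, hx, hxa⟩ := ContinuousLinearMap.exists_lt_apply_of_lt_opNorm _ hlt
    rcases le_abs.1 hxa.le with h1 | h1
    · exact ⟨x, hx.le, h1⟩
    · exact ⟨-x, by simpa using hx.le, by rwa [map_neg]⟩
  refine ⟨C₁ ∩ {f | f x ≤ w₀ x + ε / 2}, inter_subset_left.trans hC₁C,
    hC₁.inter_halfspace hw₀ x (half_pos hε), g, hg, fun w hw => ⟨?_, ?_⟩⟩
  · exact (hgt w (limitFunctionals_mono inter_subset_left hw)).trans hta.le
  · have hwx : w x ≤ w₀ x + ε / 2 := hw x _ ⟨0, fun f hf => hf.1.2⟩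
    have h1 : (h + s • g - w) x ≤ ‖h + s • g - w‖ :=
      (Real.le_norm_self _).trans (ContinuousLinearMap.unit_le_opNorm _ x hx)
    simp only [sub_apply] at h1 hxa
    linarith

lemma sInf_distanceBounds_le (hK : Antitone K) (hKc : ∀ n, Convex ℝ (K n))
    (hR : ∀ n, ∀ f ∈ K n, ‖f‖ ≤ R) (hR0 : 0 ≤ R) (hC : Convex ℝ C) (hC' : ConvexMeeting K C')
    (hsub : C' ⊆ C) (h g : E →L[ℝ] ℝ) {r : ℝ} (hr0 : 0 ≤ r) (hr1 : r ≤ 1) (s : ℝ) {n : ℕ}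
    (hg : g ∈ C ∩ K n) :
    sInf (distanceBounds K C h s n) ≤
      sInf (distanceBounds K C' (h + ((1 - r) * s) • g) (s * r) (n + 1)) := by
  refine csInf_le_csInf ⟨0, fun t ht => le_of_mem_distanceBounds hK hR ht⟩
    (distanceBounds_nonempty hR hR0 hC' _ _ _) ?_
  rintro t ⟨C'', hC''C', hC'', g', hg', hb⟩
  refine ⟨C'', hC''C'.trans hsub, hC'', (1 - r) • g + r • g', ?_, fun w hw => ?_⟩
  · exact (hC.inter (hKc n)) hg ⟨hsub hg'.1, hK n.le_succ hg'.2⟩ (by linarith) hr0 (by ring)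
  · convert hb w hw using 2
    module

/-- A form of James' sup theorem: if a decreasing sequence of nonempty, uniformly bounded convex
sets of functionals stays away from its limit functionals, then some functional does not attain
its norm on the closed unit ball. -/
theorem exists_nonattaining_of_limitFunctionals (hK : Antitone K) (hKc : ∀ n, Convex ℝ (K n))
    (hKne : ∀ n, (K n).Nonempty) (hR : ∀ n, ∀ f ∈ K n, ‖f‖ ≤ R) {θ : ℝ} (hθ : 0 < θ)
    (hsep : ∀ f ∈ K 0, ∀ w ∈ limitFunctionals K univ, θ ≤ ‖f - w‖) :
    ∃ F : E →L[ℝ] ℝ, ∀ x : E, ‖x‖ ≤ 1 → F x ≠ ‖F‖ := by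
  have hR0 : 0 ≤ R := by
    obtain ⟨f, hf⟩ := hKne 0
    exact (norm_nonneg f).trans (hR 0 f hf)
  set r : ℝ := θ / (8 * R + 2 * θ) with hr
  have hr0 : 0 < r := by positivity
  have hrmul : r * (8 * R + 2 * θ) = θ := div_mul_cancel₀ _ (by positivity)
  have hr1 : r < 1 := by
    rw [hr, div_lt_one (by positivity)]
    linarith
  have hrR : 8 * (R * r) ≤ θ := by nlinarith
  set ε : ℕ → ℝ := fun n => θ / 2 * (r / 2) ^ (n + 1) with hεdef
  have hε : ∀ n, 0 < ε n := fun n => by positivity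
  have hstep : ∀ (n : ℕ) (p : {C // ConvexMeeting K C} × (E →L[ℝ] ℝ)),
      ∃ (C' : {C // ConvexMeeting K C}) (g : E →L[ℝ] ℝ), C'.1 ⊆ p.1.1 ∧ g ∈ p.1.1 ∩ K n ∧
        ∀ w ∈ limitFunctionals K C'.1,
          ‖p.2 + r ^ n • g - w‖ ≤ sInf (distanceBounds K p.1.1 p.2 (r ^ n) n) + ε n ∧
          sInf (distanceBounds K p.1.1 p.2 (r ^ n) n) ≤ ‖p.2 + r ^ n • g - w‖ + ε n := by
    intro n p
    obtain ⟨C', hsub, hC', g, hg, hw⟩ :=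
      exists_almost_constant_distance hK hR hR0 p.1.2 p.2 (r ^ n) n (hε n)
    exact ⟨⟨C', hC'⟩, g, hsub, hg, hw⟩
  choose next pick hnext hpick hdist using hstep
  let state : ℕ → {C // ConvexMeeting K C} × (E →L[ℝ] ℝ) := fun n =>
    Nat.rec (⟨univ, convex_univ, fun n => by simpa using hKne n⟩, 0)
      (fun n p => (next n p, p.2 + ((1 - r) * r ^ n) • pick n p)) n
  let C : ℕ → Set (E →L[ℝ] ℝ) := fun n => (state n).1.1
  let h : ℕ → E →L[ℝ] ℝ := fun n => (state n).2
  let g : ℕ → E →L[ℝ] ℝ := fun n => pick n (state n)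
  let a : ℕ → ℝ := fun n => sInf (distanceBounds K (C n) (h n) (r ^ n) n)
  have hh0 : h 0 = 0 := rfl
  have hhs : ∀ n, h (n + 1) = h n + ((1 - r) * r ^ n) • g n := fun n => rfl
  have hCmeet : ∀ n, ConvexMeeting K (C n) := fun n => (state n).1.2
  have hCanti : Antitone C := antitone_nat_of_succ_le fun n => hnext n (state n)
  have hg : ∀ n, g n ∈ C n ∩ K n := fun n => hpick n (state n)
  have hgR : ∀ n, ‖g n‖ ≤ R := fun n => hR n _ (hg n).2
  have ha : Monotone a := monotone_nat_of_le_succ fun n =>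
    (sInf_distanceBounds_le hK hKc hR hR0 (hCmeet n).1 (hCmeet (n + 1)) (hCanti n.le_succ) (h n)
      (g n) hr0.le hr1.le (r ^ n) (hg n))
  have ha0 : θ ≤ a 0 := by
    refine le_csInf (distanceBounds_nonempty hR hR0 (hCmeet 0) _ _ _) ?_
    rintro t ⟨C', -, hC', f, hf, hb⟩
    obtain ⟨w, hw⟩ := limitFunctionals_nonempty hK hR hC'
    have h1 := hb w hw
    have h2 := hsep f hf.2 w (limitFunctionals_mono (subset_univ _) hw)
    simp only [hh0, pow_zero, one_smul, zero_add] at h1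
    exact h2.trans h1
  obtain ⟨w, hw⟩ := exists_pointwise_hyperfilter_limit g R hgR
  have hwL : ∀ m, w ∈ limitFunctionals K (C m) := fun m =>
    mem_limitFunctionals_of_tendsto hK hw m fun n hn => ⟨hCanti hn (hg n).1, (hg n).2⟩
  have hdist_succ : ∀ n, dist (h n) (h (n + 1)) ≤ ((1 - r) * R) * r ^ n := fun n => by
    rw [hhs, dist_self_add_right, norm_smul, Real.norm_of_nonneg
      (mul_nonneg (by linarith) (by positivity))]
    have := mul_le_mul_of_nonneg_left (hgR n)
      (show 0 ≤ (1 - r) * r ^ n from mul_nonneg (by linarith) (by positivity))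
    linarith
  obtain ⟨H, hH⟩ := cauchySeq_tendsto_of_complete (cauchySeq_of_le_geometric r _ hr1 hdist_succ)
  have htail : ∀ n, ‖H - h n‖ ≤ R * r ^ n := fun n => by
    have := dist_le_of_le_geometric_of_tendsto r _ hr1 hdist_succ hH n
    rw [dist_comm, dist_eq_norm] at this
    convert this using 1
    field_simp [show (1 - r) ≠ 0 by linarith]
  have hrpow : Tendsto (fun n : ℕ => r ^ n) atTop (𝓝 0) :=
    tendsto_pow_atTop_nhds_zero_of_lt_one hr0.le hr1
  have hεlim : Tendsto ε atTop (𝓝 0) := by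
    have h1 := (tendsto_pow_atTop_nhds_zero_of_lt_one (r := r / 2) (by positivity)
      (by linarith)).comp (tendsto_add_atTop_nat 1)
    simpa using h1.const_mul (θ / 2)
  have hrg : Tendsto (fun n => r ^ n • g n) atTop (𝓝 0) := by
    refine squeeze_zero_norm (a := fun n => r ^ n * R) (fun n => ?_)
      (by simpa using hrpow.mul_const R)
    rw [norm_smul, Real.norm_of_nonneg (by positivity)]
    exact mul_le_mul_of_nonneg_left (hgR n) (by positivity)
  have haA : ∀ n, a n ≤ ‖H - w‖ := fun n => by
    have hlim : Tendsto (fun m => ‖h m + r ^ m • g m - w‖ + ε m) atTop (𝓝 ‖H - w‖) := by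
      simpa using (((hH.add hrg).sub_const w).norm).add hεlim
    refine ge_of_tendsto hlim ?_
    filter_upwards [eventually_ge_atTop n] with m hm
    exact (ha hm).trans (hdist m (state m) w (hwL (m + 1))).2
  have hpartial : ∀ n, ‖h n - (1 - r ^ n) • w‖ ≤
      ‖H - w‖ - θ / 2 * (1 + (1 / 2) ^ n) * r ^ n := by
    intro n
    induction n with
    | zero =>
      have := haA 0
      simp only [hh0, pow_zero, sub_self, zero_smul, norm_zero]
      linarith
    | succ n ih =>
      have h1 : ‖h n + r ^ n • g n - w‖ ≤ ‖H - w‖ + ε n :=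
        (hdist n (state n) w (hwL (n + 1))).1.trans (by linarith [haA n])
      have h2 : h (n + 1) - (1 - r ^ (n + 1)) • w =
          (1 - r) • (h n + r ^ n • g n - w) + r • (h n - (1 - r ^ n) • w) := by
        rw [hhs]
        module
      have h3 : ‖h (n + 1) - (1 - r ^ (n + 1)) • w‖ ≤
          (1 - r) * ‖h n + r ^ n • g n - w‖ + r * ‖h n - (1 - r ^ n) • w‖ := by
        rw [h2]
        refine (norm_add_le _ _).trans_eq ?_
        rw [norm_smul, norm_smul, Real.norm_of_nonneg (by linarith), Real.norm_of_nonneg hr0.le]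
      have h4 := mul_le_mul_of_nonneg_left h1 (show 0 ≤ 1 - r by linarith)
      have h5 := mul_le_mul_of_nonneg_left ih hr0.le
      have h6 : 0 ≤ r * ε n := mul_nonneg hr0.le (hε n).le
      have h7 : ε n = θ / 2 * (1 / 2) ^ n * r ^ n * r / 2 := by
        simp only [hεdef, div_pow, one_pow, pow_succ]
        field_simp
      have h8 : θ / 2 * (1 + (1 / 2) ^ (n + 1)) * r ^ (n + 1) =
          r * (θ / 2 * (1 + (1 / 2) ^ n) * r ^ n) - θ / 2 * (1 / 2) ^ n * r ^ n * r / 2 := by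
        ring
      linarith
  refine ⟨H - w, fun x hx hxA => ?_⟩
  have hgap : ∀ n, w x + θ / 4 ≤ g n x := fun n => by
    have h1 : (h n - (1 - r ^ n) • w) x ≤ ‖h n - (1 - r ^ n) • w‖ :=
      (Real.le_norm_self _).trans (ContinuousLinearMap.unit_le_opNorm _ x hx)
    have h2 : (H - h (n + 1)) x ≤ ‖H - h (n + 1)‖ :=
      (Real.le_norm_self _).trans (ContinuousLinearMap.unit_le_opNorm _ x hx)
    have h3 : |g n x| ≤ R := (ContinuousLinearMap.unit_le_opNorm _ x hx).trans (hgR n)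
    have h4 := htail (n + 1)
    have h5 := hpartial n
    have h6 : 0 < r ^ n := by positivity
    have h7 : 0 ≤ θ / 2 * (1 / 2) ^ n * r ^ n := by positivity
    rw [hhs] at h2 h4
    simp only [sub_apply, add_apply,
      smul_apply, smul_eq_mul] at h1 h2 hxA
    have h8 : r ^ n * (θ / 2) ≤ r ^ n * ((1 - r) * g n x + R * r - w x) := by
      rw [pow_succ] at h4
      linarith
    have h9 := le_of_mul_le_mul_left h8 h6
    have h10 := mul_le_mul_of_nonneg_left (neg_le_of_abs_le h3) hr0.le
    linarith
  have := ge_of_tendsto (hw x) (Eventually.of_forall hgap)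
  linarith

end JamesSequence

section EllOne

variable {B : Type*} [NormedAddCommGroup B] [NormedSpace ℝ B]

/-- A bounded functional on the domain of a map that is bounded below extends along that map. -/
lemma exists_comp_eq_of_bounded_below {V : Type*} [NormedAddCommGroup V] [NormedSpace ℝ V]
    (T : V →L[ℝ] B) {c : ℝ} (hc : 0 < c) (hT : ∀ v, c * ‖v‖ ≤ ‖T v‖) (φ : V →L[ℝ] ℝ) :
    ∃ f : B →L[ℝ] ℝ, ‖f‖ ≤ ‖φ‖ / c ∧ ∀ v, f (T v) = φ v := by
  have hinj : Function.Injective T.toLinearMap := by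
    refine (injective_iff_map_eq_zero _).2 fun v hv => ?_
    have h1 := hT v
    rw [show T v = 0 from hv, norm_zero] at h1
    exact norm_le_zero_iff.1 (nonpos_of_mul_nonpos_right h1 hc)
  let e := LinearEquiv.ofInjective T.toLinearMap hinj
  let ψ : LinearMap.range T.toLinearMap →L[ℝ] ℝ :=
    (φ.toLinearMap ∘ₗ e.symm.toLinearMap).mkContinuous (‖φ‖ / c) fun y => by
      obtain ⟨v, rfl⟩ := e.surjective y
      have h1 : ‖φ v‖ ≤ ‖φ‖ * ‖v‖ := φ.le_opNorm v
      have h2 : ‖v‖ ≤ ‖T v‖ / c := (le_div_iff₀' hc).2 (hT v)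
      have h3 : ‖e v‖ = ‖T v‖ := rfl
      simp only [LinearMap.comp_apply, LinearEquiv.coe_coe, LinearEquiv.symm_apply_apply, h3,
        ContinuousLinearMap.coe_coe]
      calc ‖φ v‖ ≤ ‖φ‖ * (‖T v‖ / c) := h1.trans (by gcongr)
        _ = ‖φ‖ / c * ‖T v‖ := by ring
  obtain ⟨f, hf, hfn⟩ := exists_extension_norm_eq _ ψ
  refine ⟨f, hfn.le.trans (LinearMap.mkContinuous_norm_le _ (by positivity) _), fun v => ?_⟩
  have h1 := hf (e v)
  rw [show ((e v : LinearMap.range T.toLinearMap) : B) = T v from rfl] at h1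
  rw [h1]
  simp [ψ]

/-- The sum of the coordinates of index at least `n`, as a functional on `ℓ¹`. -/
lemma exists_tail_sum_functional (n : ℕ) :
    ∃ φ : lp (fun _ : ℕ => ℝ) 1 →L[ℝ] ℝ, ‖φ‖ ≤ 1 ∧
      ∀ k, φ (lp.single 1 k (1 : ℝ)) = if n ≤ k then 1 else 0 := by
  have hsum : ∀ v : lp (fun _ : ℕ => ℝ) 1, Summable fun k => ‖v k‖ := fun v => by
    simpa using (lp.memℓp v).summable (by simp)
  have hle : ∀ (v : lp (fun _ : ℕ => ℝ) 1) k, ‖if n ≤ k then v k else 0‖ ≤ ‖v k‖ := fun v k => by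
    split_ifs <;> simp
  have hsum' : ∀ v : lp (fun _ : ℕ => ℝ) 1, Summable fun k => if n ≤ k then v k else 0 :=
    fun v => .of_norm_bounded (hsum v) (hle v)
  let φ : lp (fun _ : ℕ => ℝ) 1 →ₗ[ℝ] ℝ :=
    { toFun v := ∑' k, if n ≤ k then v k else 0
      map_add' u v := by
        rw [← (hsum' u).tsum_add (hsum' v)]
        congr 1 with k
        split_ifs <;> simp
      map_smul' a v := by
        rw [RingHom.id_apply, smul_eq_mul, ← tsum_mul_left]
        congr 1 with k
        split_ifs <;> simp }
  refine ⟨φ.mkContinuous 1 fun v => ?_, LinearMap.mkContinuous_norm_le _ zero_le_one _,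
    fun k => ?_⟩
  · rw [one_mul, lp.norm_eq_tsum_rpow (by simp)]
    simpa [φ] using tsum_of_norm_bounded (hsum v).hasSum (hle v)
  · change ∑' j, (if n ≤ j then (lp.single 1 k (1 : ℝ) : lp (fun _ : ℕ => ℝ) 1) j else 0) = _
    rw [tsum_eq_single k fun j hj => by simp [hj]]
    simp

end EllOne

/-- If a Banach space contains a closed subspace linearly isomorphic to `ℓ¹`, then some
continuous linear functional does not attain its norm on the closed unit ball. -/
theorem l1_subspace_exists_nonattaining {B : Type*} [NormedAddCommGroup B] [NormedSpace ℝ B]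
    [CompleteSpace B]
    (T : lp (fun _ : ℕ => ℝ) 1 →L[ℝ] B) (c : ℝ) (hc : 0 < c)
    (hT : ∀ v, c * ‖v‖ ≤ ‖T v‖) :
    ∃ f : B →L[ℝ] ℝ, ∀ x : B, ‖x‖ ≤ 1 → f x ≠ ‖f‖ := by
  let y : ℕ → B := fun k => T (lp.single 1 k (1 : ℝ))
  have hy : ∀ k, ‖y k‖ ≤ ‖T‖ := fun k => by
    simpa [lp.norm_single] using T.le_opNorm (lp.single 1 k (1 : ℝ))
  let K : ℕ → Set (B →L[ℝ] ℝ) := fun n =>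
    {f | ‖f‖ ≤ 1 / c ∧ (∀ k < n, f (y k) = 0) ∧ ∃ N, ∀ k ≥ N, f (y k) = 1}
  refine exists_nonattaining_of_limitFunctionals (K := K) (R := 1 / c) (θ := 1 / (‖T‖ + 1))
    ?_ ?_ ?_ (fun n f hf => hf.1) (by positivity) ?_
  · exact fun m n hmn f hf => ⟨hf.1, fun k hk => hf.2.1 k (hk.trans_le hmn), hf.2.2⟩
  · rintro n f ⟨hf, hf0, N, hN⟩ g ⟨hg, hg0, M, hM⟩ a b ha hb hab
    refine ⟨?_, fun k hk => by simp [hf0 k hk, hg0 k hk], max N M, fun k hk => ?_⟩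
    · simpa using convex_closedBall (0 : B →L[ℝ] ℝ) (1 / c) (by simpa using hf)
        (by simpa using hg) ha hb hab
    · simp [hN k (le_of_max_le_left hk), hM k (le_of_max_le_right hk), hab]
  · intro n
    obtain ⟨φ, hφ, hφk⟩ := exists_tail_sum_functional n
    obtain ⟨f, hf, hfT⟩ := exists_comp_eq_of_bounded_below T hc hT φ
    refine ⟨f, hf.trans (by gcongr), fun k hk => ?_, n, fun k hk => ?_⟩
    · simp only [y]
      rw [hfT, hφk, if_neg (by omega)]
    · simp only [y]
      rw [hfT, hφk, if_pos hk]
  · rintro f ⟨-, -, N, hN⟩ w hw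
    have hwN : w (y N) ≤ 0 := hw _ _ ⟨N + 1, fun g hg => (hg.2.2.1 N N.lt_succ_self).le⟩
    have h1 : (f - w) (y N) ≤ ‖f - w‖ * ‖y N‖ := (le_abs_self _).trans ((f - w).le_opNorm _)
    rw [sub_apply, hN N le_rfl] at h1
    rw [div_le_iff₀ (by positivity)]
    have h2 : ‖f - w‖ * ‖y N‖ ≤ ‖f - w‖ * (‖T‖ + 1) := by
      gcongr
      linarith [hy N]
    linarith
end

section
/- Let B be a Banach space with an unconditional Schauder basis (z_i). Then (z_i) fails to be shrinking if and only if B contains a closed subspace linearly isomorphic to ℓ¹. -/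
open Filter

/-- `x` is a Schauder basis of `B`. -/
def IsSchauderBasis {B : Type*} [NormedAddCommGroup B] [NormedSpace ℝ B] (x : ℕ → B) : Prop :=
  ∀ y : B, ∃! a : ℕ → ℝ,
    Tendsto (fun N => ∑ i ∈ Finset.range N, a i • x i) atTop (nhds y)

/-- The basis `x` is unconditional: every basis expansion converges unconditionally. -/
def IsUnconditional {B : Type*} [NormedAddCommGroup B] [NormedSpace ℝ B] (x : ℕ → B) : Prop :=
  ∀ (y : B) (a : ℕ → ℝ),
    Tendsto (fun N => ∑ i ∈ Finset.range N, a i • x i) atTop (nhds y) →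
    HasSum (fun i => a i • x i) y

/-- The basis `x` is shrinking. -/
def Shrinking {B : Type*} [NormedAddCommGroup B] [NormedSpace ℝ B] (x : ℕ → B) : Prop :=
  ∀ f : B →L[ℝ] ℝ, ∀ ε > (0:ℝ), ∃ N : ℕ, ∀ n ≥ N,
    ∀ v ∈ Submodule.span ℝ (x '' {i | n ≤ i}), ‖v‖ ≤ 1 → |f v| ≤ ε

noncomputable section

variable {B : Type*} [NormedAddCommGroup B] [NormedSpace ℝ B] {z : ℕ → B}

namespace IsSchauderBasis

/-- The coordinates of a vector with respect to a Schauder basis. -/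
def coord (hb : IsSchauderBasis z) : B →ₗ[ℝ] ℕ → ℝ where
  toFun y := (hb y).choose
  map_add' x y := by
    refine (hb (x + y)).unique (hb (x + y)).choose_spec.1 ?_
    simpa [add_smul, Finset.sum_add_distrib] using
      (hb x).choose_spec.1.add (hb y).choose_spec.1
  map_smul' c x := by
    refine (hb (c • x)).unique (hb (c • x)).choose_spec.1 ?_
    simpa [mul_smul, Finset.smul_sum] using (hb x).choose_spec.1.const_smul c

lemma tendsto_coord (hb : IsSchauderBasis z) (y : B) :
    Tendsto (fun N => ∑ i ∈ Finset.range N, hb.coord y i • z i) atTop (nhds y) :=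
  (hb y).choose_spec.1

lemma coord_eq_of_tendsto (hb : IsSchauderBasis z) {y : B} {a : ℕ → ℝ}
    (h : Tendsto (fun N => ∑ i ∈ Finset.range N, a i • z i) atTop (nhds y)) :
    hb.coord y = a :=
  (hb y).unique (hb.tendsto_coord y) h

lemma coord_eq_of_sum (hb : IsSchauderBasis z) (s : Finset ℕ) (a : ℕ → ℝ) (i : ℕ) :
    hb.coord (∑ j ∈ s, a j • z j) i = if i ∈ s then a i else 0 := by
  have h : Tendsto (fun N => ∑ j ∈ Finset.range N, (if j ∈ s then a j else 0) • z j) atTop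
      (nhds (∑ j ∈ s, a j • z j)) := by
    have : HasSum (fun j => (if j ∈ s then a j else 0) • z j)
        (∑ j ∈ s, (if j ∈ s then a j else 0) • z j) :=
      hasSum_sum_of_ne_finset_zero fun j hj => by simp [hj]
    rw [Finset.sum_congr rfl fun j hj => by rw [if_pos hj]] at this
    exact this.tendsto_sum_nat
  exact congrFun (hb.coord_eq_of_tendsto h) i

lemma coord_self (hb : IsSchauderBasis z) (i j : ℕ) :
    hb.coord (z i) j = if j = i then 1 else 0 := by
  simpa using hb.coord_eq_of_sum {i} 1 j

lemma ne_zero (hb : IsSchauderBasis z) (i : ℕ) : z i ≠ 0 := by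
  intro h
  simpa [h] using hb.coord_self i i

/-- The projection onto the span of the basis vectors with indices in `s`. -/
def proj (hb : IsSchauderBasis z) (s : Finset ℕ) : B →ₗ[ℝ] B :=
  ∑ i ∈ s, ((LinearMap.proj i).comp hb.coord).smulRight (z i)

lemma proj_apply (hb : IsSchauderBasis z) (s : Finset ℕ) (x : B) :
    hb.proj s x = ∑ i ∈ s, hb.coord x i • z i := by
  simp [proj]

lemma tendsto_proj (hb : IsSchauderBasis z) (x : B) :
    Tendsto (fun N => hb.proj (Finset.range N) x) atTop (nhds x) := by
  simpa only [proj_apply] using hb.tendsto_coord x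

lemma proj_eq_self (hb : IsSchauderBasis z) {s : Finset ℕ} {x : B}
    (h : ∀ i ∉ s, hb.coord x i = 0) : hb.proj s x = x := by
  have : HasSum (fun i => hb.coord x i • z i) (hb.proj s x) := by
    rw [proj_apply]
    exact hasSum_sum_of_ne_finset_zero fun j hj => by simp [h j hj]
  exact tendsto_nhds_unique this.tendsto_sum_nat (hb.tendsto_coord x)

lemma proj_eq_zero (hb : IsSchauderBasis z) {s : Finset ℕ} {x : B}
    (h : ∀ i ∈ s, hb.coord x i = 0) : hb.proj s x = 0 := by
  rw [proj_apply]
  exact Finset.sum_eq_zero fun i hi => by simp [h i hi]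

lemma bddAbove_norm_proj (hb : IsSchauderBasis z) (hu : IsUnconditional z) (x : B) :
    BddAbove (Set.range fun s => ‖hb.proj s x‖) := by
  have hs := hu x _ (hb.tendsto_coord x)
  obtain ⟨t, ht⟩ := (Metric.tendsto_atTop.1 hs) 1 one_pos
  refine ⟨‖x‖ + 1 + ∑ i ∈ t, ‖hb.coord x i • z i‖, ?_⟩
  rintro _ ⟨s, rfl⟩
  have h1 := ht (s ∪ t) Finset.subset_union_right
  have h2 := Finset.sum_union (f := fun i => hb.coord x i • z i)
    (Finset.disjoint_sdiff (s := s) (t := t))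
  rw [Finset.union_sdiff_self_eq_union] at h2
  have h3 : ‖∑ i ∈ t \ s, hb.coord x i • z i‖ ≤ ∑ i ∈ t, ‖hb.coord x i • z i‖ :=
    (norm_sum_le _ _).trans (Finset.sum_le_sum_of_subset_of_nonneg Finset.sdiff_subset
      fun _ _ _ => norm_nonneg _)
  rw [dist_eq_norm] at h1
  have h4 : hb.proj s x = (∑ i ∈ s ∪ t, hb.coord x i • z i - x) + x
      - ∑ i ∈ t \ s, hb.coord x i • z i := by
    rw [h2, proj_apply]; abel
  have h5 := norm_sub_le (∑ i ∈ s ∪ t, hb.coord x i • z i - x + x)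
    (∑ i ∈ t \ s, hb.coord x i • z i)
  have h6 := norm_add_le (∑ i ∈ s ∪ t, hb.coord x i • z i - x) x
  simp only [h4]
  linarith

/-- The family of all finite basis projections of a vector, as a bounded family. -/
def projFamily (hb : IsSchauderBasis z) (hu : IsUnconditional z) :
    B →ₗ[ℝ] lp (fun _ : Finset ℕ => B) ⊤ where
  toFun x := ⟨fun s => hb.proj s x, memℓp_infty (hb.bddAbove_norm_proj hu x)⟩
  map_add' x y := by ext s; exact map_add (hb.proj s) x y
  map_smul' c x := by ext s; simp

lemma projFamily_apply (hb : IsSchauderBasis z) (hu : IsUnconditional z) (x : B)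
    (s : Finset ℕ) : hb.projFamily hu x s = hb.proj s x := rfl

lemma continuous_projFamily [CompleteSpace B] (hb : IsSchauderBasis z)
    (hu : IsUnconditional z) : Continuous (hb.projFamily hu) := by
  refine LinearMap.continuous_of_seq_closed_graph _ fun u x y hx hy => ?_
  have hyS (s : Finset ℕ) : Tendsto (fun k => hb.proj s (u k)) atTop (nhds (y s)) :=
    ((lp.lipschitzWith_one_eval ⊤ s).continuous.tendsto y).comp hy
  have hspan (i : ℕ) : ∃ b : ℝ, b • z i = y {i} := by
    refine Submodule.mem_span_singleton.1 <|
      (Submodule.closed_of_finiteDimensional (Submodule.span ℝ {z i})).mem_of_tendsto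
        (hyS {i}) (.of_forall fun k => ?_)
    simpa [proj_apply] using Submodule.smul_mem _ _ (Submodule.mem_span_singleton_self (z i))
  choose b hb' using hspan
  have hsum (s : Finset ℕ) : y s = ∑ i ∈ s, b i • z i := by
    refine tendsto_nhds_unique (hyS s) ?_
    simp only [hb', hb.proj_apply s]
    exact tendsto_finsetSum s fun i _ => by simpa [proj_apply] using hyS {i}
  have hlim : Tendsto (fun N => ∑ i ∈ Finset.range N, b i • z i) atTop (nhds x) := by
    rw [Metric.tendsto_atTop]
    intro ε hε
    obtain ⟨k, hk1, hk2⟩ := ((Metric.tendsto_nhds.1 hx (ε / 3) (by positivity)).and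
      (Metric.tendsto_nhds.1 hy (ε / 3) (by positivity))).exists
    obtain ⟨N, hN⟩ := Metric.tendsto_atTop.1 (hb.tendsto_proj (u k)) (ε / 3) (by positivity)
    refine ⟨N, fun n hn => ?_⟩
    have h1 := hN n hn
    have h2 : dist (hb.proj (Finset.range n) (u k)) (y (Finset.range n)) < ε / 3 := by
      refine lt_of_le_of_lt ?_ hk2
      simpa [dist_eq_norm, projFamily_apply] using
        lp.norm_apply_le_norm ENNReal.top_ne_zero (hb.projFamily hu (u k) - y) (Finset.range n)
    rw [← hsum]
    have h3 := dist_triangle4 (y (Finset.range n)) (hb.proj (Finset.range n) (u k)) (u k) x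
    rw [dist_comm (y _) (hb.proj _ _)] at h3
    linarith
  ext s
  rw [projFamily_apply, hsum, proj_apply, hb.coord_eq_of_tendsto hlim]

lemma exists_norm_proj_le [CompleteSpace B] (hb : IsSchauderBasis z)
    (hu : IsUnconditional z) : ∃ C > 0, ∀ s x, ‖hb.proj s x‖ ≤ C * ‖x‖ := by
  let Φ : B →L[ℝ] lp (fun _ : Finset ℕ => B) ⊤ :=
    ⟨hb.projFamily hu, hb.continuous_projFamily hu⟩
  refine ⟨‖Φ‖ + 1, by positivity, fun s x => ?_⟩
  have h1 : ‖hb.proj s x‖ ≤ ‖Φ x‖ := lp.norm_apply_le_norm ENNReal.top_ne_zero (Φ x) s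
  have h2 := Φ.le_opNorm x
  nlinarith [norm_nonneg x]

lemma exists_continuous_coord [CompleteSpace B] (hb : IsSchauderBasis z)
    (hu : IsUnconditional z) (i : ℕ) : ∃ φ : B →L[ℝ] ℝ, ∀ x, φ x = hb.coord x i := by
  obtain ⟨C, -, hC⟩ := hb.exists_norm_proj_le hu
  refine ⟨((LinearMap.proj i).comp hb.coord).mkContinuous (C / ‖z i‖) fun x => ?_,
    fun x => rfl⟩
  have h := hC {i} x
  have hz := norm_pos_iff.2 (hb.ne_zero i)
  rw [proj_apply, Finset.sum_singleton, norm_smul] at h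
  rw [div_mul_eq_mul_div, le_div_iff₀ hz]
  exact h

lemma exists_coord_eq_zero_of_mem_span (hb : IsSchauderBasis z) {n : ℕ} {v : B}
    (hv : v ∈ Submodule.span ℝ (z '' {i | n ≤ i})) :
    ∃ M, n ≤ M ∧ ∀ i ∉ Finset.Ico n M, hb.coord v i = 0 := by
  obtain ⟨l, hl, rfl⟩ := (Finsupp.mem_span_image_iff_linearCombination ℝ).1 hv
  obtain ⟨M, hM⟩ := l.support.bddAbove
  refine ⟨max n (M + 1), le_max_left _ _, fun i hi => ?_⟩
  rw [Finsupp.linearCombination_apply, Finsupp.sum, hb.coord_eq_of_sum, if_neg]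
  intro h
  have h1 : n ≤ i := hl h
  have h2 : i ≤ M := hM h
  simp only [Finset.mem_Ico, not_and, not_lt, max_le_iff] at hi
  have := hi h1
  omega

/-- The coordinate functionals of a shrinking basis span a dense subspace of the dual. -/
lemma isSeparable_dual_of_shrinking [CompleteSpace B] (hb : IsSchauderBasis z)
    (hu : IsUnconditional z) (hs : Shrinking z) :
    TopologicalSpace.IsSeparable (Set.univ : Set (B →L[ℝ] ℝ)) := by
  choose φ hφ using hb.exists_continuous_coord hu
  obtain ⟨C, hC0, hC⟩ := hb.exists_norm_proj_le hu
  refine ((Set.countable_range φ).isSeparable.span (R := ℝ)).closure.mono fun f _ => ?_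
  rw [Metric.mem_closure_iff]
  intro ε hε
  obtain ⟨N, hN⟩ := hs f (ε / (2 * (1 + C))) (by positivity)
  refine ⟨∑ i ∈ Finset.range N, f (z i) • φ i, Submodule.sum_mem _ fun i _ =>
    Submodule.smul_mem _ _ (Submodule.subset_span ⟨i, rfl⟩), ?_⟩
  have htail (v : B) (hv : v ∈ Submodule.span ℝ (z '' {i | N ≤ i})) :
      |f v| ≤ ε / (2 * (1 + C)) * ‖v‖ := by
    rcases eq_or_ne v 0 with rfl | hv0
    · simp
    have hv0 := norm_pos_iff.2 hv0
    have h := hN N le_rfl (‖v‖⁻¹ • v) (Submodule.smul_mem _ _ hv)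
      (by rw [norm_smul, norm_inv, norm_norm, inv_mul_cancel₀ hv0.ne'])
    rw [map_smul, smul_eq_mul, abs_mul, abs_inv, abs_norm, inv_mul_le_iff₀ hv0] at h
    linarith
  rw [dist_eq_norm]
  refine lt_of_le_of_lt (ContinuousLinearMap.opNorm_le_bound _ (half_pos hε).le fun x => ?_)
    (half_lt_self hε)
  have hx : (f - ∑ i ∈ Finset.range N, f (z i) • φ i) x
      = f (x - hb.proj (Finset.range N) x) := by
    simp [proj_apply, hφ, mul_comm]
  have hlim : Tendsto (fun M => hb.proj (Finset.range M) x - hb.proj (Finset.range N) x) atTop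
      (nhds (x - hb.proj (Finset.range N) x)) := (hb.tendsto_proj x).sub_const _
  have hle := le_of_tendsto_of_tendsto (f.continuous.abs.tendsto _ |>.comp hlim)
    ((hlim.norm).const_mul (ε / (2 * (1 + C)))) <| by
      filter_upwards [eventually_ge_atTop N] with M hM
      refine htail _ ?_
      simp only [proj_apply]
      rw [← Finset.sum_Ico_eq_sub _ hM]
      exact Submodule.sum_mem _ fun i hi => Submodule.smul_mem _ _
        (Submodule.subset_span ⟨i, (Finset.mem_Ico.1 hi).1, rfl⟩)
  rw [hx, Real.norm_eq_abs]
  refine hle.trans ?_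
  have h1 : ‖x - hb.proj (Finset.range N) x‖ ≤ (1 + C) * ‖x‖ := by
    linarith [norm_sub_le x (hb.proj (Finset.range N) x), hC (Finset.range N) x]
  calc ε / (2 * (1 + C)) * ‖x - hb.proj (Finset.range N) x‖
      ≤ ε / (2 * (1 + C)) * ((1 + C) * ‖x‖) := by gcongr
    _ = ε / 2 * ‖x‖ := by field_simp

end IsSchauderBasis

lemma lp_one_hasSum_norm (a : lp (fun _ : ℕ => ℝ) 1) : HasSum (fun k => ‖a k‖) ‖a‖ := by
  simpa using lp.hasSum_norm (by simp) a

/-- A sequence in the unit ball of a Banach space induces an operator on `ℓ¹`. -/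
lemma exists_lp_one_lift {E : Type*} [NormedAddCommGroup E] [NormedSpace ℝ E] [CompleteSpace E]
    {v : ℕ → E} (hv : ∀ k, ‖v k‖ ≤ 1) :
    ∃ T : lp (fun _ : ℕ => ℝ) 1 →L[ℝ] E, ∀ a, HasSum (fun k => a k • v k) (T a) := by
  have hle (a : lp (fun _ : ℕ => ℝ) 1) (k : ℕ) : ‖a k • v k‖ ≤ ‖a k‖ := by
    rw [norm_smul]
    exact mul_le_of_le_one_right (norm_nonneg _) (hv k)
  have hsum (a : lp (fun _ : ℕ => ℝ) 1) : Summable fun k => a k • v k :=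
    .of_norm_bounded (lp_one_hasSum_norm a).summable (hle a)
  let L : lp (fun _ : ℕ => ℝ) 1 →ₗ[ℝ] E :=
    { toFun := fun a => ∑' k, a k • v k
      map_add' := fun a b => by
        simpa [add_smul] using (hsum a).tsum_add (hsum b)
      map_smul' := fun c a => by
        simpa [mul_smul] using (hsum a).tsum_const_smul c }
  refine ⟨L.mkContinuous 1 fun a => ?_, fun a => (hsum a).hasSum⟩
  rw [one_mul]
  exact tsum_of_norm_bounded (lp_one_hasSum_norm a) (hle a)

/-- A continuous functional extends along an operator that is bounded below. -/
lemma exists_dual_comp_eq {E : Type*} [NormedAddCommGroup E] [NormedSpace ℝ E]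
    (T : E →L[ℝ] B) {c : ℝ} (hc : 0 < c) (hT : ∀ v, c * ‖v‖ ≤ ‖T v‖) (g : E →L[ℝ] ℝ) :
    ∃ h : B →L[ℝ] ℝ, ∀ v, h (T v) = g v := by
  have hinj : Function.Injective T := by
    rw [injective_iff_map_eq_zero]
    intro v hv
    have := hT v
    rw [hv, norm_zero] at this
    exact norm_le_zero_iff.1 (nonpos_of_mul_nonpos_right this hc)
  let e := LinearEquiv.ofInjective (T : E →ₗ[ℝ] B) hinj
  let f : LinearMap.range (T : E →ₗ[ℝ] B) →L[ℝ] ℝ :=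
    ((g : E →ₗ[ℝ] ℝ).comp (e.symm : _ →ₗ[ℝ] E)).mkContinuous (‖g‖ / c) fun w => by
      obtain ⟨v, rfl⟩ := e.surjective w
      have h1 : ‖e v‖ = ‖T v‖ := rfl
      have h2 := hT v
      have h3 := g.le_opNorm v
      simp only [LinearMap.comp_apply, LinearEquiv.coe_coe, LinearEquiv.symm_apply_apply, h1]
      rw [div_mul_eq_mul_div, le_div_iff₀ hc]
      calc ‖g v‖ * c ≤ ‖g‖ * ‖v‖ * c := by gcongr
        _ = ‖g‖ * (c * ‖v‖) := by ring
        _ ≤ ‖g‖ * ‖T v‖ := by gcongr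
  obtain ⟨h, hh, -⟩ := exists_extension_norm_eq _ f
  refine ⟨h, fun v => ?_⟩
  have h1 := hh (e v)
  have h2 : f (e v) = g v := by simp [f]
  exact h1.trans h2

/-- A Banach space containing `ℓ¹` has a nonseparable dual. -/
lemma not_isSeparable_dual_of_lp_one (T : lp (fun _ : ℕ => ℝ) 1 →L[ℝ] B) {c : ℝ} (hc : 0 < c)
    (hT : ∀ v, c * ‖v‖ ≤ ‖T v‖) :
    ¬ TopologicalSpace.IsSeparable (Set.univ : Set (B →L[ℝ] ℝ)) := by
  classical
  rintro ⟨D, hD, hdense⟩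
  have hex (A : Set ℕ) : ∃ h : B →L[ℝ] ℝ, ∀ k,
      h (T (lp.single 1 k (1 : ℝ))) = if k ∈ A then 1 else 0 := by
    obtain ⟨g, hg⟩ := exists_lp_one_lift (E := ℝ) (v := fun k => if k ∈ A then 1 else 0)
      fun k => by split_ifs <;> simp
    obtain ⟨h, hh⟩ := exists_dual_comp_eq T hc hT g
    refine ⟨h, fun k => ?_⟩
    rw [hh]
    refine (hg _).unique ?_
    have := hasSum_single (f := fun j => (lp.single 1 k (1 : ℝ) : ℕ → ℝ) j •
      (if j ∈ A then (1 : ℝ) else 0)) k fun j hj => by simp [hj]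
    simpa using this
  choose h hh using hex
  have hδ : 0 < 1 / (2 * (‖T‖ + 1)) := by positivity
  choose d hd hdist using fun A => Metric.mem_closure_iff.1 (hdense (Set.mem_univ (h A))) _ hδ
  have hinj : Function.Injective fun A => (⟨d A, hd A⟩ : D) := by
    intro A A' hAA
    have hAA : d A = d A' := congrArg Subtype.val hAA
    by_contra hne
    obtain ⟨k, hk⟩ : ∃ k, ¬ (k ∈ A ↔ k ∈ A') := by
      by_contra! hcon
      exact hne (Set.ext hcon)
    have h1 : 1 ≤ ‖(h A - h A') (T (lp.single 1 k (1 : ℝ)))‖ := by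
      rw [sub_apply, hh, hh]
      by_cases hA : k ∈ A <;> by_cases hA' : k ∈ A' <;> simp_all
    have h2 : ‖T (lp.single 1 k (1 : ℝ))‖ ≤ ‖T‖ := by
      simpa [lp.norm_single] using T.le_opNorm (lp.single 1 k (1 : ℝ))
    have h3 : ‖h A - h A'‖ < 1 / (‖T‖ + 1) := by
      rw [← dist_eq_norm]
      have h4 := hdist A
      have h5 := hdist A'
      rw [← hAA, dist_comm] at h5
      calc dist (h A) (h A') ≤ dist (h A) (d A) + dist (d A) (h A') := dist_triangle _ _ _
        _ < 1 / (2 * (‖T‖ + 1)) + 1 / (2 * (‖T‖ + 1)) := add_lt_add h4 h5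
        _ = 1 / (‖T‖ + 1) := by field_simp; norm_num
    rw [lt_div_iff₀ (by positivity)] at h3
    have h6 := (h A - h A').le_opNorm (T (lp.single 1 k (1 : ℝ)))
    have h7 := mul_le_mul_of_nonneg_left h2 (norm_nonneg (h A - h A'))
    linarith [norm_nonneg (h A - h A')]
  have := hD.to_subtype
  obtain ⟨e, he⟩ := exists_injective_nat D
  exact Function.cantor_injective _ (he.comp hinj)

/-- Along a nonshrinking basis there is a block sequence in the unit ball on which a functional
is bounded away from zero. -/
lemma IsSchauderBasis.exists_block_sequence (hb : IsSchauderBasis z) (hs : ¬ Shrinking z) :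
    ∃ (f : B →L[ℝ] ℝ) (ε : ℝ) (N : ℕ → ℕ) (v : ℕ → B), 0 < ε ∧ Monotone N ∧
      ∀ k, ‖v k‖ ≤ 1 ∧ ε ≤ f (v k) ∧
        ∀ i ∉ Finset.Ico (N k) (N (k + 1)), hb.coord (v k) i = 0 := by
  unfold Shrinking at hs
  push Not at hs
  obtain ⟨f, ε, hε, hs⟩ := hs
  have hstep (m : ℕ) : ∃ (w : B) (M : ℕ), m ≤ M ∧ ‖w‖ ≤ 1 ∧ ε ≤ f w ∧
      ∀ i ∉ Finset.Ico m M, hb.coord w i = 0 := by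
    obtain ⟨n, hn, w, hw, hw1, hfw⟩ := hs m
    obtain ⟨M, hnM, hM⟩ := hb.exists_coord_eq_zero_of_mem_span hw
    have hM' : ∀ i ∉ Finset.Ico m M, hb.coord w i = 0 := fun i hi =>
      hM i fun h => hi (Finset.Ico_subset_Ico_left hn h)
    rcases le_total 0 (f w) with h | h
    · exact ⟨w, M, hn.trans hnM, hw1, by rw [abs_of_nonneg h] at hfw; exact hfw.le, hM'⟩
    · refine ⟨-w, M, hn.trans hnM, by simpa using hw1, ?_, fun i hi => by simp [hM' i hi]⟩
      rw [abs_of_nonpos h] at hfw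
      simpa using hfw.le
  choose w M hM hw using hstep
  let N : ℕ → ℕ := fun k => M^[k] 0
  have hN (k : ℕ) : N (k + 1) = M (N k) := Function.iterate_succ_apply' M k 0
  refine ⟨f, ε, N, fun k => w (N k), hε, monotone_nat_of_le_succ fun k => ?_, fun k => ?_⟩
  · rw [hN]; exact hM _
  · rw [hN]; exact hw _

lemma exists_lp_one_of_not_shrinking [CompleteSpace B] (hb : IsSchauderBasis z)
    (hu : IsUnconditional z) (hs : ¬ Shrinking z) :
    ∃ (T : lp (fun _ : ℕ => ℝ) 1 →L[ℝ] B) (c : ℝ), 0 < c ∧ ∀ v, c * ‖v‖ ≤ ‖T v‖ := by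
  classical
  obtain ⟨f, ε, N, v, hε, hN, hv⟩ := hb.exists_block_sequence hs
  obtain ⟨C, hC0, hC⟩ := hb.exists_norm_proj_le hu
  obtain ⟨T, hT⟩ := exists_lp_one_lift fun k => (hv k).1
  have hproj (K : Finset ℕ) (k : ℕ) :
      hb.proj (K.biUnion fun j => Finset.Ico (N j) (N (j + 1))) (v k)
        = if k ∈ K then v k else 0 := by
    split_ifs with hk
    · exact hb.proj_eq_self fun i hi => (hv k).2.2 i fun h =>
        hi (Finset.mem_biUnion.2 ⟨k, hk, h⟩)
    · refine hb.proj_eq_zero fun i hi => (hv k).2.2 i fun h => ?_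
      obtain ⟨j, hj, hij⟩ := Finset.mem_biUnion.1 hi
      have hjk : j ≠ k := fun e => hk (e ▸ hj)
      have hd : Disjoint (Set.Ico (N j) (N (j + 1))) (Set.Ico (N k) (N (k + 1))) :=
        hN.pairwise_disjoint_on_Ico_succ hjk
      exact hd.notMem_of_mem_left (Finset.mem_Ico.1 hij) (Finset.mem_Ico.1 h)
  have hpart (a : ℕ → ℝ) (n : ℕ) (K : Finset ℕ) (hK : K ⊆ Finset.range n) :
      |∑ k ∈ K, a k * f (v k)| ≤ ‖f‖ * C * ‖∑ k ∈ Finset.range n, a k • v k‖ := by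
    have h1 : hb.proj (K.biUnion fun j => Finset.Ico (N j) (N (j + 1)))
        (∑ k ∈ Finset.range n, a k • v k) = ∑ k ∈ K, a k • v k := by
      simp [hproj, Finset.inter_eq_right.2 hK, Finset.sum_ite_mem]
    have h2 := f.le_opNorm (∑ k ∈ K, a k • v k)
    have h3 := hC (K.biUnion fun j => Finset.Ico (N j) (N (j + 1)))
      (∑ k ∈ Finset.range n, a k • v k)
    rw [h1] at h3
    have h4 := mul_le_mul_of_nonneg_left h3 (norm_nonneg f)
    simp only [map_sum, map_smul, smul_eq_mul, Real.norm_eq_abs] at h2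
    linarith
  have hfin (a : ℕ → ℝ) (n : ℕ) : ε * ∑ k ∈ Finset.range n, ‖a k‖
      ≤ 2 * (‖f‖ * C) * ‖∑ k ∈ Finset.range n, a k • v k‖ := by
    have hpos := (le_abs_self _).trans
      (hpart a n ((Finset.range n).filter fun k => 0 ≤ a k) (Finset.filter_subset _ _))
    have hneg := (neg_le_abs _).trans
      (hpart a n ((Finset.range n).filter fun k => ¬ 0 ≤ a k) (Finset.filter_subset _ _))
    rw [← Finset.sum_neg_distrib] at hneg
    have hle : ε * ∑ k ∈ Finset.range n, ‖a k‖
        ≤ ∑ k ∈ Finset.range n with 0 ≤ a k, a k * f (v k)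
          + ∑ k ∈ Finset.range n with ¬ 0 ≤ a k, -(a k * f (v k)) := by
      rw [Finset.mul_sum, ← Finset.sum_filter_add_sum_filter_not _ fun k => 0 ≤ a k]
      refine add_le_add (Finset.sum_le_sum fun k hk => ?_) (Finset.sum_le_sum fun k hk => ?_)
      · have h := (Finset.mem_filter.1 hk).2
        rw [Real.norm_of_nonneg h]
        nlinarith [(hv k).2.1]
      · have h := (not_le.1 (Finset.mem_filter.1 hk).2).le
        rw [Real.norm_of_nonpos h]
        nlinarith [(hv k).2.1]
    linarith
  refine ⟨T, ε / (2 * (‖f‖ * C) + 1), by positivity, fun a => ?_⟩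
  have hlim := le_of_tendsto_of_tendsto'
    ((lp_one_hasSum_norm a).tendsto_sum_nat.const_mul ε)
    ((hT a).tendsto_sum_nat.norm.const_mul (2 * (‖f‖ * C))) (hfin a)
  rw [div_mul_eq_mul_div, div_le_iff₀ (by positivity)]
  linarith [norm_nonneg (T a)]

end

/-- An unconditional Schauder basis fails to be shrinking iff the space contains a closed
subspace linearly isomorphic to `ℓ¹`. -/
theorem not_shrinking_iff_contains_l1 {B : Type*} [NormedAddCommGroup B]
    [NormedSpace ℝ B] [CompleteSpace B] (z : ℕ → B)
    (hb : IsSchauderBasis z) (hu : IsUnconditional z) :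
    ¬ Shrinking z ↔
      ∃ (T : lp (fun _ : ℕ => ℝ) 1 →L[ℝ] B) (c : ℝ), 0 < c ∧
        ∀ v, c * ‖v‖ ≤ ‖T v‖ := by
  refine ⟨exists_lp_one_of_not_shrinking hb hu, ?_⟩
  rintro ⟨T, c, hc, hT⟩ hs
  exact not_isSeparable_dual_of_lp_one T hc hT (hb.isSeparable_dual_of_shrinking hu hs)
end

section
/- Every uniformly non-square Banach space is reflexive. -/
open Filter in
/-- `EventuallyTuple n P`: for nested hyperfilter-many choices of the first `n` entries (all later
entries being `0`), the sequence satisfies `P`. -/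
def EventuallyTuple : ℕ → ((ℕ → ℕ) → Prop) → Prop
  | 0, P => P 0
  | n + 1, P => ∀ᶠ a in (hyperfilter ℕ : Filter ℕ),
      EventuallyTuple n fun f => P fun i => Nat.casesOn i a f

namespace EventuallyTuple

open Filter

theorem of_forall {n : ℕ} {P : (ℕ → ℕ) → Prop} (h : ∀ f, P f) : EventuallyTuple n P := by
  induction n generalizing P with
  | zero => exact h 0
  | succ n ih => exact Eventually.of_forall fun a => ih fun f => h _

theorem mono {n : ℕ} {P Q : (ℕ → ℕ) → Prop} (hP : EventuallyTuple n P) (h : ∀ f, P f → Q f) :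
    EventuallyTuple n Q := by
  induction n generalizing P Q with
  | zero => exact h 0 hP
  | succ n ih => exact Eventually.mono hP fun a ha => ih ha fun f => h _

theorem and {n : ℕ} {P Q : (ℕ → ℕ) → Prop} (hP : EventuallyTuple n P)
    (hQ : EventuallyTuple n Q) : EventuallyTuple n fun f => P f ∧ Q f := by
  induction n generalizing P Q with
  | zero => exact ⟨hP, hQ⟩
  | succ n ih => exact (Eventually.and hP hQ).mono fun a ha => ih ha.1 ha.2

theorem exists_of {n : ℕ} {P : (ℕ → ℕ) → Prop} (hP : EventuallyTuple n P) : ∃ f, P f := by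
  by_contra! h
  have : EventuallyTuple n fun _ => False := hP.mono h
  clear hP
  induction n with
  | zero => exact this
  | succ n ih =>
    obtain ⟨a, ha⟩ := Eventually.exists this
    exact ih ha

theorem not_of {n : ℕ} {P : (ℕ → ℕ) → Prop} (hP : ¬ EventuallyTuple n P) :
    EventuallyTuple n fun f => ¬ P f := by
  induction n generalizing P with
  | zero => exact hP
  | succ n ih => exact (Ultrafilter.eventually_not.2 hP).mono fun a ha => ih ha

theorem lt_and_increasing (n N : ℕ) : EventuallyTuple n fun f =>
    (∀ i < n, N < f i) ∧ ∀ i j, i < j → j < n → f i < f j := by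
  induction n generalizing N with
  | zero => exact ⟨by simp, by simp⟩
  | succ n ih =>
    have hlt : ∀ᶠ a in (hyperfilter ℕ : Filter ℕ), N < a :=
      Nat.hyperfilter_le_atTop (eventually_gt_atTop N)
    refine hlt.mono fun a ha => (ih a).mono fun f hf => ⟨?_, ?_⟩
    · rintro (_ | i) hi
      · exact ha
      · exact ha.trans (hf.1 i (by omega))
    · rintro (_ | i) (_ | j) hij hj
      · omega
      · exact hf.1 j (by omega)
      · omega
      · exact hf.2 i j (by omega) (by omega)

theorem comp_strictMono {m n : ℕ} {P : (ℕ → ℕ) → Prop} {ρ : ℕ → ℕ} (hρ : StrictMono ρ)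
    (hlt : ∀ i < n, ρ i < m) (hP : ∀ f g, (∀ i < n, f i = g i) → P f → P g)
    (h : EventuallyTuple n P) : EventuallyTuple m fun f => P (f ∘ ρ) := by
  induction m generalizing n P ρ with
  | zero =>
    obtain rfl : n = 0 := by
      by_contra hn
      exact absurd (hlt 0 (by omega)) (by omega)
    exact hP _ _ (by simp) h
  | succ m ih =>
    rcases n with _ | n
    · exact of_forall fun f => hP _ _ (by simp) h
    rcases Nat.eq_zero_or_pos (ρ 0) with h0 | h0
    · have hpos : ∀ i, 0 < ρ (i + 1) := fun i => by
        have : ρ 0 < ρ (i + 1) := hρ (by omega)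
        omega
      refine Eventually.mono h fun a ha => ?_
      refine (ih (ρ := fun i => ρ (i + 1) - 1) ?_ ?_ ?_ ha).mono fun f hf => ?_
      · intro i j hij
        have : ρ (i + 1) < ρ (j + 1) := hρ (by omega)
        have := hpos i
        dsimp only
        omega
      · intro i hi
        have := hlt (i + 1) (by omega)
        have := hpos i
        omega
      · intro f g hfg
        refine hP _ _ ?_
        rintro (_ | i) hi
        · rfl
        · exact hfg i (by omega)
      · convert hf using 1
        funext i
        rcases i with _ | i
        · simp [h0]
        · obtain ⟨k, hk⟩ : ∃ k, ρ (i + 1) = k + 1 := ⟨ρ (i + 1) - 1, by have := hpos i; omega⟩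
          simp [hk]
    · have hpos : ∀ i, 0 < ρ i := fun i => h0.trans_le (hρ.monotone (Nat.zero_le i))
      refine Eventually.of_forall fun a => ?_
      refine (ih (ρ := fun i => ρ i - 1) ?_ ?_ hP h).mono fun f hf => ?_
      · intro i j hij
        have := hρ hij
        have := hpos i
        dsimp only
        omega
      · intro i hi
        have := hlt i hi
        have := hpos i
        omega
      · convert hf using 1
        funext i
        obtain ⟨k, hk⟩ : ∃ k, ρ i = k + 1 := ⟨ρ i - 1, by have := hpos i; omega⟩
        simp [hk]

end EventuallyTuple

section

variable {E : Type*} [NormedAddCommGroup E] [NormedSpace ℝ E]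

/-- **Helly's theorem**: a functional of norm less than one on the dual agrees on finitely many
functionals with evaluation at a vector of the unit ball. -/
theorem exists_norm_le_one_forall_apply_eq {ι : Type*} [Fintype ι] (f : ι → StrongDual ℝ E)
    (Φ : StrongDual ℝ (StrongDual ℝ E)) (hΦ : ‖Φ‖ < 1) :
    ∃ x : E, ‖x‖ ≤ 1 ∧ ∀ i, f i x = Φ (f i) := by
  classical
  obtain ⟨r, hr, hr1⟩ := exists_between hΦ
  have hr0 : 0 < r := (norm_nonneg Φ).trans_lt hr
  let T : E →L[ℝ] (ι → ℝ) := ContinuousLinearMap.pi f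
  let v : ι → ℝ := fun i => Φ (f i)
  have hconv : Convex ℝ (closure (T '' Metric.closedBall 0 r)) :=
    ((convex_closedBall (0 : E) r).is_linear_image T.toLinearMap.isLinear).closure
  have hv : v ∈ closure (T '' Metric.closedBall 0 r) := by
    by_contra hv
    obtain ⟨c, u, hc, hu⟩ := geometric_hahn_banach_closed_point hconv isClosed_closure hv
    have hle : ∀ x : E, ‖x‖ ≤ r → c (T x) < u := fun x hx =>
      hc _ (subset_closure ⟨x, by simpa using hx, rfl⟩)
    have hu0 : 0 ≤ u := by
      have := hle 0 (by simpa using hr0.le)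
      simp only [map_zero] at this
      exact this.le
    have hnorm : ‖c.comp T‖ ≤ u / r := by
      refine ContinuousLinearMap.opNorm_le_of_unit_norm (by positivity) fun x hx => ?_
      have h1 := hle (r • x) (by rw [norm_smul, hx, Real.norm_of_nonneg hr0.le, mul_one])
      have h2 := hle (-(r • x))
        (by rw [norm_neg, norm_smul, hx, Real.norm_of_nonneg hr0.le, mul_one])
      simp only [map_neg, map_smul, smul_eq_mul] at h1 h2
      rw [ContinuousLinearMap.comp_apply, Real.norm_eq_abs, le_div_iff₀ hr0, mul_comm]
      nth_rewrite 1 [← abs_of_pos hr0]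
      rw [← abs_mul, abs_le]
      constructor <;> linarith
    have hcomp : c.comp T = ∑ i, c (Pi.single i 1) • f i := by
      ext x
      have := LinearMap.pi_apply_eq_sum_univ c.toLinearMap (T x)
      simp only [ContinuousLinearMap.coe_coe] at this
      simp only [ContinuousLinearMap.comp_apply, this, _root_.sum_apply,
        _root_.smul_apply, smul_eq_mul]
      refine Finset.sum_congr rfl fun i _ => ?_
      rw [mul_comm]
      congr 2
      ext j
      simp [Pi.single_apply, eq_comm]
    have hcv : c v = Φ (c.comp T) := by
      have := LinearMap.pi_apply_eq_sum_univ c.toLinearMap v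
      simp only [ContinuousLinearMap.coe_coe] at this
      rw [this, hcomp, map_sum]
      refine Finset.sum_congr rfl fun i _ => ?_
      rw [map_smul, smul_eq_mul, smul_eq_mul, mul_comm]
      congr 2
      ext j
      simp [Pi.single_apply, eq_comm]
    have h1 : Φ (c.comp T) ≤ ‖Φ‖ * ‖c.comp T‖ := (le_abs_self _).trans (Φ.le_opNorm _)
    have h2 : ‖Φ‖ * ‖c.comp T‖ ≤ r * (u / r) := by gcongr
    rw [mul_div_cancel₀ _ hr0.ne'] at h2
    linarith
  let R := LinearMap.range T.toLinearMap
  let T' : E →L[ℝ] R := T.codRestrict R fun x => ⟨x, rfl⟩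
  obtain ⟨S, hS⟩ := T'.exists_rightInverse_of_surjective <| LinearMap.range_eq_top.2 <| by
    rintro ⟨_, x, rfl⟩
    exact ⟨x, rfl⟩
  have hvR : v ∈ R := by
    have hcl : IsClosed (R : Set (ι → ℝ)) := R.closed_of_finiteDimensional
    refine closure_minimal ?_ hcl hv
    rintro _ ⟨x, -, rfl⟩
    exact ⟨x, rfl⟩
  have hε : 0 < (1 - r) / (‖S‖ + 1) := by
    have := norm_nonneg S
    exact div_pos (by linarith) (by linarith)
  obtain ⟨_, ⟨x, hx, rfl⟩, hxv⟩ := Metric.mem_closure_iff.1 hv _ hε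
  have hx : ‖x‖ ≤ r := by simpa using hx
  let w : R := ⟨v, hvR⟩ - T' x
  have hw : ‖w‖ < (1 - r) / (‖S‖ + 1) := by
    rw [dist_eq_norm] at hxv
    exact hxv
  refine ⟨x + S w, ?_, fun i => ?_⟩
  · have h1 : ‖S w‖ ≤ ‖S‖ * ‖w‖ := S.le_opNorm w
    have h2 : ‖w‖ * (‖S‖ + 1) < 1 - r := by
      rwa [lt_div_iff₀ (by positivity)] at hw
    have h3 := norm_add_le x (S w)
    nlinarith [norm_nonneg w]
  · have h1 : T' (S w) = w := congrArg (fun L : R →L[ℝ] R => L w) hS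
    have h2 : T (x + S w) = v := by
      rw [map_add]
      have h3 : T (S w) = v - T x := congrArg Subtype.val h1
      rw [h3, add_sub_cancel]
    exact congrFun h2 i

set_option maxSynthPendingDepth 6 in
/-- **James**: a non-reflexive Banach space carries a biorthogonal-type triangular system. -/
theorem exists_triangular_system [CompleteSpace E]
    (hE : ¬ Function.Surjective (NormedSpace.inclusionInDoubleDual ℝ E)) :
    ∃ θ : ℝ, 0 < θ ∧ ∃ (g : ℕ → StrongDual ℝ E) (x : ℕ → E), (∀ n, ‖g n‖ ≤ 1) ∧
      (∀ n, ‖x n‖ ≤ 1) ∧ (∀ m n, m ≤ n → g m (x n) = θ) ∧ ∀ m n, n < m → g m (x n) = 0 := by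
  classical
  let J := NormedSpace.inclusionInDoubleDualLi (E := E) ℝ
  obtain ⟨F₀, hF₀⟩ : ∃ F₀, ∀ x, J x ≠ F₀ := by
    by_contra! H
    exact hE H
  have hrange : IsClosed (LinearMap.range J.toLinearMap : Set (StrongDual ℝ (StrongDual ℝ E))) :=
    J.isometry.isUniformInducing.isComplete_range.isClosed
  obtain ⟨φ₀, u, hφ, hu⟩ := geometric_hahn_banach_closed_point
    (LinearMap.range J.toLinearMap).convex hrange (x := F₀) (by rintro ⟨x, hx⟩; exact hF₀ x hx)
  have hφJ : ∀ x, φ₀ (J x) = 0 := fun x => by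
    by_contra hne
    have := hφ (J ((u / φ₀ (J x)) • x)) ⟨_, rfl⟩
    rw [map_smul, map_smul, smul_eq_mul, div_mul_cancel₀ _ hne] at this
    exact lt_irrefl _ this
  have hφF : 0 < φ₀ F₀ := by
    have := hφ (J 0) ⟨_, rfl⟩
    rw [hφJ] at this
    exact this.trans hu
  have hshrink : ∀ a : ℝ, 0 ≤ a → (a + 1)⁻¹ * a < 1 := fun a ha => by
    rw [inv_mul_lt_iff₀ (by positivity)]
    linarith
  let F := (‖F₀‖ + 1)⁻¹ • F₀
  let φ := (‖φ₀‖ + 1)⁻¹ • φ₀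
  have hF1 : ‖F‖ < 1 := by
    rw [norm_smul, Real.norm_of_nonneg (by positivity)]
    exact hshrink _ (norm_nonneg _)
  have hφ1 : ‖φ‖ < 1 := by
    rw [norm_smul, Real.norm_of_nonneg (by positivity)]
    exact hshrink _ (norm_nonneg _)
  have hθ : 0 < φ F := by
    simp only [F, φ, _root_.smul_apply, map_smul, smul_eq_mul]
    positivity
  obtain ⟨p, hp, hpr⟩ := exists_seq_of_forall_finset_exists
    (fun p : StrongDual ℝ E × E => ‖p.1‖ ≤ 1 ∧ ‖p.2‖ ≤ 1 ∧ F p.1 = φ F ∧ p.1 p.2 = φ F)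
    (fun p q => q.1 p.2 = 0 ∧ p.1 q.2 = φ F) <| by
      intro s hs
      obtain ⟨g, hg1, hg⟩ := exists_norm_le_one_forall_apply_eq
        (fun o : Option s => o.elim F fun p => J p.1.2) φ hφ1
      have hgF : F g = φ F := hg none
      have hgs : ∀ p ∈ s, g p.2 = 0 := fun p hps => by
        have h1 : J p.2 g = φ (J p.2) := hg (some ⟨p, hps⟩)
        have h2 : φ (J p.2) = 0 := by
          simp only [φ, _root_.smul_apply, hφJ, smul_zero]
        rw [h2] at h1
        exact h1
      obtain ⟨x, hx1, hx⟩ := exists_norm_le_one_forall_apply_eq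
        (fun o : Option s => o.elim g fun p => p.1.1) F hF1
      refine ⟨(g, x), ⟨hg1, hx1, hgF, (hx none).trans hgF⟩, fun p hps => ⟨hgs p hps, ?_⟩⟩
      exact (hx (some ⟨p, hps⟩)).trans (hs p hps).2.2.1
  refine ⟨φ F, hθ, fun n => (p n).1, fun n => (p n).2, fun n => (hp n).1, fun n => (hp n).2.1,
    fun m n hmn => ?_, fun m n hnm => (hpr n m hnm).1⟩
  rcases hmn.eq_or_lt with rfl | hlt
  · exact (hp m).2.2.2
  · exact (hpr m n hlt).2

/-- `z` has `n` consecutive blocks, delimited by `σ`, on which the values `g k z` are at least `θ`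
in absolute value, with alternating signs. -/
def Alternates (g : ℕ → StrongDual ℝ E) (θ : ℝ) (n : ℕ) (σ : ℕ → ℕ) (z : E) : Prop :=
  ∀ i < n, ∀ k, σ (2 * i) ≤ k → k ≤ σ (2 * i + 1) → θ ≤ (-1) ^ i * g k z

theorem Alternates.congr {g : ℕ → StrongDual ℝ E} {θ : ℝ} {n : ℕ} {σ τ : ℕ → ℕ} {z : E}
    (h : Alternates g θ n σ z) (hστ : ∀ i < 2 * n, τ i = σ i) : Alternates g θ n τ z := by
  intro i hi k h1 h2
  rw [hστ _ (by omega)] at h1 h2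
  exact h i hi k h1 h2

theorem exists_alternates {g : ℕ → StrongDual ℝ E} {x : ℕ → E} {θ : ℝ}
    (hx : ∀ n, ‖x n‖ ≤ 1) (hle : ∀ m n, m ≤ n → g m (x n) = θ)
    (hlt : ∀ m n, n < m → g m (x n) = 0) (n : ℕ) {σ : ℕ → ℕ}
    (hσ : ∀ i j, i < j → j < 2 * n → σ i < σ j) :
    ∃ z : E, ‖z‖ ≤ 2 * n + 1 ∧ Alternates g θ n σ z := by
  suffices H : ∀ M, (∀ i < 2 * n, σ i ≤ M) → ∃ z : E, ‖z‖ ≤ 2 * n + 1 ∧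
      (∀ i < n, ∀ k, σ (2 * i) ≤ k → k ≤ σ (2 * i + 1) → g k z = (-1) ^ i * θ) ∧
      (∀ k, (∀ i < 2 * n, σ i < k) → k ≤ M → g k z = (-1) ^ n * θ) ∧ ∀ k, M < k → g k z = 0 by
    obtain ⟨z, hz, hblock, -⟩ := H (∑ i ∈ Finset.range (2 * n), σ i) fun i hi =>
      Finset.single_le_sum (fun _ _ => Nat.zero_le _) (Finset.mem_range.2 hi)
    refine ⟨z, hz, fun i hi k h1 h2 => ?_⟩
    rw [hblock i hi k h1 h2, ← mul_assoc, ← pow_add, Even.neg_one_pow ⟨i, rfl⟩, one_mul]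
  induction n with
  | zero =>
    intro M _
    refine ⟨x M, by simpa using hx M, by simp, fun k _ hk => ?_, fun k hk => hlt k M hk⟩
    simpa using hle k M hk
  | succ n ih =>
    intro M hM
    have hlast : σ (2 * n + 1) ≤ M := hM _ (by omega)
    obtain ⟨z, hz, hblock, hgap, hzero⟩ :=
      ih (fun i j hij hj => hσ i j hij (by omega)) (σ (2 * n + 1))
        fun i hi => (hσ i _ (by omega) (by omega)).le
    have hpow : (-1 : ℝ) ^ (n + 1) = -(-1) ^ n := by rw [pow_succ]; ring
    refine ⟨z + ((-1 : ℝ) ^ n • x (σ (2 * n + 1)) + (-1 : ℝ) ^ (n + 1) • x M), ?_, ?_, ?_, ?_⟩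
    · have h1 := norm_add_le z ((-1 : ℝ) ^ n • x (σ (2 * n + 1)) + (-1 : ℝ) ^ (n + 1) • x M)
      have h2 := norm_add_le ((-1 : ℝ) ^ n • x (σ (2 * n + 1))) ((-1 : ℝ) ^ (n + 1) • x M)
      simp only [norm_smul, norm_pow, norm_neg, norm_one, one_pow, one_mul] at h2
      have := hx (σ (2 * n + 1))
      have := hx M
      push_cast
      linarith
    all_goals simp only [map_add, map_smul, smul_eq_mul]
    · intro i hi k h1 h2
      rcases Nat.lt_succ_iff_lt_or_eq.1 hi with hi' | rfl
      · have hk : k ≤ σ (2 * n + 1) := h2.trans (hσ _ _ (by omega) (by omega)).le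
        rw [hblock i hi' k h1 h2, hle k _ hk, hle k _ (hk.trans hlast), hpow]
        ring
      · have : g k z = (-1) ^ i * θ := hgap k
          (fun j hj => (hσ j (2 * i) hj (by omega)).trans_le h1) h2
        rw [this, hle k _ h2, hle k _ (h2.trans hlast), hpow]
        ring
    · intro k hk hkM
      have hk' := hk (2 * n + 1) (by omega)
      rw [hzero k hk', hlt k _ hk', hle k _ hkM]
      ring
    · intro k hk
      rw [hzero k (hlast.trans_lt hk), hlt k _ (hlast.trans_lt hk), hlt k _ hk]
      ring

/-- Lower bounds for the norms of vectors alternating over generic blocks. -/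
def alternationBounds (g : ℕ → StrongDual ℝ E) (θ : ℝ) (n : ℕ) : Set ℝ :=
  {K | EventuallyTuple (2 * n) fun σ => ∀ z, Alternates g θ n σ z → K ≤ ‖z‖}

theorem exists_norm_add_sub_ge {g : ℕ → StrongDual ℝ E} {θ : ℝ} {n : ℕ} {K K' L : ℝ}
    (hK : K ∈ alternationBounds g θ n) (hK' : K' ∈ alternationBounds g θ (n + 1))
    (hL : L ∉ alternationBounds g θ (n + 1)) :
    ∃ x y : E, ‖x‖ < L ∧ ‖y‖ < L ∧ 2 * K' ≤ ‖x + y‖ ∧ 2 * K ≤ ‖x - y‖ := by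
  have hL' := EventuallyTuple.not_of hL
  have hcongr : ∀ (n : ℕ) (L : ℝ) (σ τ : ℕ → ℕ), (∀ i < 2 * n, σ i = τ i) →
      (∀ z, Alternates g θ n σ z → L ≤ ‖z‖) → ∀ z, Alternates g θ n τ z → L ≤ ‖z‖ :=
    fun n L σ τ h H z hz => H z (hz.congr h)
  have hp := hL'.comp_strictMono (m := 4 * n + 6) (ρ := fun j => 4 * (j / 2) + 3 * (j % 2))
    (fun i j hij => by dsimp only; omega) (fun i hi => by omega)
    fun σ τ h => mt (hcongr (n + 1) L τ σ fun i hi => (h i hi).symm)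
  have hq := hL'.comp_strictMono (m := 4 * n + 6) (ρ := fun j => 4 * (j / 2) + 2 + 3 * (j % 2))
    (fun i j hij => by dsimp only; omega) (fun i hi => by omega)
    fun σ τ h => mt (hcongr (n + 1) L τ σ fun i hi => (h i hi).symm)
  have hr := hK'.comp_strictMono (m := 4 * n + 6) (ρ := fun j => 4 * (j / 2) + 2 + j % 2)
    (fun i j hij => by dsimp only; omega) (fun i hi => by omega) (hcongr (n + 1) K')
  have hs := hK.comp_strictMono (m := 4 * n + 6) (ρ := fun j => 4 * (j / 2) + 4 + j % 2)
    (fun i j hij => by dsimp only; omega) (fun i hi => by omega) (hcongr n K)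
  obtain ⟨t, ⟨hp, hq⟩, ⟨hr, hs⟩, -, ht⟩ := ((hp.and hq).and
    ((hr.and hs).and (EventuallyTuple.lt_and_increasing (4 * n + 6) 0))).exists_of
  push Not at hp hq
  obtain ⟨x, hx, hxL⟩ := hp
  obtain ⟨y, hy, hyL⟩ := hq
  have hxs : ∀ i ≤ n, ∀ k, t (4 * i) ≤ k → k ≤ t (4 * i + 3) → θ ≤ (-1) ^ i * g k x := by
    intro i hi k h1 h2
    refine hx i (by omega) k (le_of_eq_of_le (congrArg t ?_) h1)
      (le_of_le_of_eq h2 (congrArg t ?_)) <;> dsimp only <;> omega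
  have hys : ∀ i ≤ n, ∀ k, t (4 * i + 2) ≤ k → k ≤ t (4 * i + 5) → θ ≤ (-1) ^ i * g k y := by
    intro i hi k h1 h2
    refine hy i (by omega) k (le_of_eq_of_le (congrArg t ?_) h1)
      (le_of_le_of_eq h2 (congrArg t ?_)) <;> dsimp only <;> omega
  have hhalf : ∀ z : E, ‖(1 / 2 : ℝ) • z‖ = ‖z‖ / 2 := fun z => by
    rw [norm_smul, Real.norm_of_nonneg (by norm_num)]
    ring
  refine ⟨x, y, hxL, hyL, ?_, ?_⟩
  · have := hr ((1 / 2 : ℝ) • (x + y)) fun i hi k h1 h2 => by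
      have h1 : t (4 * i + 2) ≤ k := le_of_eq_of_le (congrArg t (by dsimp only; omega)) h1
      have h2 : k ≤ t (4 * i + 3) := le_of_le_of_eq h2 (congrArg t (by dsimp only; omega))
      have hx' := hxs i (by omega) k ((ht (4 * i) _ (by omega) (by omega)).le.trans h1) h2
      have hy' := hys i (by omega) k h1 (h2.trans (ht _ (4 * i + 5) (by omega) (by omega)).le)
      simp only [map_smul, map_add, smul_eq_mul]
      linarith
    rw [hhalf] at this
    linarith
  · have := hs ((1 / 2 : ℝ) • (y - x)) fun i hi k h1 h2 => by
      have h1 : t (4 * i + 4) ≤ k := le_of_eq_of_le (congrArg t (by dsimp only; omega)) h1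
      have h2 : k ≤ t (4 * i + 5) := le_of_le_of_eq h2 (congrArg t (by dsimp only; omega))
      have hx' := hxs (i + 1) (by omega) k h1
        (h2.trans (ht _ (4 * (i + 1) + 3) (by omega) (by omega)).le)
      have hy' := hys i (by omega) k ((ht (4 * i + 2) _ (by omega) (by omega)).le.trans h1) h2
      rw [pow_succ] at hx'
      simp only [map_smul, map_sub, smul_eq_mul]
      linarith
    rw [hhalf, norm_sub_rev] at this
    linarith

end

/-- Every uniformly non-square Banach space is reflexive. -/
theorem uniformlyNonSquare_reflexive {X : Type*} [NormedAddCommGroup X] [NormedSpace ℝ X]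
    [CompleteSpace X]
    (h : ∃ δ ∈ Set.Ioo (0:ℝ) 1, ∀ x y : X, ‖x‖ ≤ 1 → ‖y‖ ≤ 1 →
        min ‖x + y‖ ‖x - y‖ ≤ 2 * (1 - δ)) :
    Function.Surjective (NormedSpace.inclusionInDoubleDual ℝ X) := by
  by_contra hX
  obtain ⟨δ, ⟨hδ0, hδ1⟩, h⟩ := h
  obtain ⟨θ, hθ, g, e, hg, he, hle, hlt⟩ := exists_triangular_system hX
  let A := alternationBounds g θ
  have hθA : ∀ n, θ ∈ A (n + 1) := fun n => by
    refine (EventuallyTuple.lt_and_increasing (2 * (n + 1)) 0).mono (Q := fun σ =>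
      ∀ z, Alternates g θ (n + 1) σ z → θ ≤ ‖z‖) fun σ hσ z hz => ?_
    have h1 := hz 0 (by omega) (σ 0) le_rfl (hσ.2 0 1 (by omega) (by omega)).le
    rw [pow_zero, one_mul] at h1
    calc θ ≤ g (σ 0) z := h1
      _ ≤ ‖g (σ 0) z‖ := le_abs_self _
      _ ≤ ‖g (σ 0)‖ * ‖z‖ := (g (σ 0)).le_opNorm z
      _ ≤ ‖z‖ := mul_le_of_le_one_left (norm_nonneg z) (hg _)
  have hub : ∀ n, ∀ K ∈ A n, K ≤ 2 * n + 1 := fun n K hK => by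
    obtain ⟨σ, hσK, -, hσ⟩ :=
      (EventuallyTuple.and hK (EventuallyTuple.lt_and_increasing (2 * n) 0)).exists_of
    obtain ⟨z, hz, hzA⟩ := exists_alternates he hle hlt n hσ
    exact (hσK z hzA).trans hz
  have hbdd : ∀ n, BddAbove (A n) := fun n => ⟨_, fun K hK => hub n K hK⟩
  have hpos : ∀ n, 0 < sSup (A (n + 1)) := fun n => hθ.trans_le (le_csSup (hbdd _) (hθA n))
  have hstep : ∀ n, ∀ K ∈ A (n + 1), K ≤ (1 - δ) * sSup (A (n + 2)) := by
    intro n K hK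
    by_contra! hlt'
    have hs := hpos (n + 1)
    obtain ⟨K', hK', hK'lt⟩ := exists_lt_of_lt_csSup ⟨θ, hθA (n + 1)⟩
      (show (1 - δ) * sSup (A (n + 2)) < sSup (A (n + 2)) by nlinarith)
    have hmin : sSup (A (n + 2)) < min K K' / (1 - δ) := by
      rw [lt_div_iff₀ (by linarith), mul_comm]
      exact lt_min hlt' hK'lt
    obtain ⟨L, hsL, hLmin⟩ := exists_between hmin
    rw [lt_div_iff₀ (by linarith)] at hLmin
    have hL0 : 0 < L := hs.trans hsL
    obtain ⟨x, y, hx, hy, hadd, hsub⟩ := exists_norm_add_sub_ge hK hK'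
      fun hLA => (le_csSup (hbdd _) hLA).not_gt hsL
    have hscale : ∀ z : X, ‖L⁻¹ • z‖ = ‖z‖ / L := fun z => by
      rw [norm_smul, Real.norm_of_nonneg (by positivity), div_eq_inv_mul]
    have := h (L⁻¹ • x) (L⁻¹ • y) (by rw [hscale, div_le_one hL0]; exact hx.le)
      (by rw [hscale, div_le_one hL0]; exact hy.le)
    rw [← smul_add, ← smul_sub, hscale, hscale, min_le_iff, div_le_iff₀ hL0,
      div_le_iff₀ hL0] at this
    have := min_le_left K K'
    have := min_le_right K K'
    rcases ‹_ ∨ _› with h' | h' <;> linarith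
  have hgrow : ∀ n, θ ≤ (1 - δ) ^ n * sSup (A (n + 1)) := by
    intro n
    induction n with
    | zero => simpa using le_csSup (hbdd _) (hθA 0)
    | succ n ih =>
      have h1 : sSup (A (n + 1)) ≤ (1 - δ) * sSup (A (n + 2)) :=
        csSup_le ⟨θ, hθA n⟩ (hstep n)
      calc θ ≤ (1 - δ) ^ n * sSup (A (n + 1)) := ih
        _ ≤ (1 - δ) ^ n * ((1 - δ) * sSup (A (n + 2))) := by
            gcongr
        _ = (1 - δ) ^ (n + 1) * sSup (A (n + 1 + 1)) := by ring
  have hlim : Filter.Tendsto (fun n : ℕ => 2 * ((n : ℝ) * (1 - δ) ^ n) + 3 * (1 - δ) ^ n)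
      Filter.atTop (nhds (2 * 0 + 3 * 0)) :=
    ((tendsto_self_mul_const_pow_of_lt_one (by linarith) (by linarith)).const_mul 2).add
      ((tendsto_pow_atTop_nhds_zero_of_lt_one (by linarith) (by linarith)).const_mul 3)
  obtain ⟨n, hn⟩ := (hlim.eventually_lt_const (show 2 * 0 + 3 * 0 < θ by linarith)).exists
  have h1 : sSup (A (n + 1)) ≤ 2 * (n + 1 : ℕ) + 1 := csSup_le ⟨θ, hθA n⟩ (hub _)
  have h2 : (1 - δ) ^ n * sSup (A (n + 1)) ≤ (1 - δ) ^ n * (2 * (n + 1 : ℕ) + 1) := by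
    gcongr
  have h3 := hgrow n
  push_cast at h2
  linarith
end
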